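/- arXiv:1403.0114 — 2 statements merged into one kernel-verified Lean document; each statement's English description precedes it below -/
import Mathlib

section
/- Let Ω_n ⊂ ℝ^d be the disjoint union of one ball of volume 1/n and n(n-1) balls of volume 1/n² each. Then |Ω_n| = 1, λ₁(Ω_n)·T(Ω_n) = (λ₁(B₁)T(B₁)/ω_d)·(n^{2/d} + n - 1)/n^{1+2/d}, and consequently λ₁(Ω_n)·T(Ω_n) → 0 as n → ∞. Hence the infimum of λ₁(Ω)T(Ω) over open sets of measure 1 is zero. -/
open MeasureTheory Metric Set Real

noncomputable def dirichletEigenvalue1 {E : Type*} [NormedAddCommGroup E] [NormedSpace ℝ E]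
    [MeasureSpace E] (Ω : Set E) : ℝ :=
  sInf {r : ℝ | ∃ u : E → ℝ, ContDiff ℝ 1 u ∧ HasCompactSupport u ∧ tsupport u ⊆ Ω ∧
    (∫ x, (u x) ^ 2) ≠ 0 ∧ r = (∫ x, ‖fderiv ℝ u x‖ ^ 2) / (∫ x, (u x) ^ 2)}

noncomputable def torsionalRigidity {E : Type*} [NormedAddCommGroup E] [NormedSpace ℝ E]
    [MeasureSpace E] (Ω : Set E) : ℝ :=
  -2 * sInf {r : ℝ | ∃ u : E → ℝ, ContDiff ℝ 1 u ∧ HasCompactSupport u ∧ tsupport u ⊆ Ω ∧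
    r = ∫ x, (‖fderiv ℝ u x‖ ^ 2 / 2 - u x)}

/-- Admissible test functions for `Ω`. -/
def Adm {d : ℕ} (Ω : Set (EuclideanSpace ℝ (Fin d))) (u : EuclideanSpace ℝ (Fin d) → ℝ) : Prop :=
  ContDiff ℝ 1 u ∧ HasCompactSupport u ∧ tsupport u ⊆ Ω

/-- The set of values of the torsion functional. -/
def TSet {d : ℕ} (Ω : Set (EuclideanSpace ℝ (Fin d))) : Set ℝ :=
  {r : ℝ | ∃ u, Adm Ω u ∧ r = ∫ x, (‖fderiv ℝ u x‖ ^ 2 / 2 - u x)}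

/-- The set of Rayleigh quotients. -/
def LSet {d : ℕ} (Ω : Set (EuclideanSpace ℝ (Fin d))) : Set ℝ :=
  {r : ℝ | ∃ u, Adm Ω u ∧ (∫ x, (u x) ^ 2) ≠ 0 ∧
    r = (∫ x, ‖fderiv ℝ u x‖ ^ 2) / (∫ x, (u x) ^ 2)}

variable {d : ℕ}

local notation "EE" => EuclideanSpace ℝ (Fin d)

lemma torsion_eq (Ω : Set EE) : torsionalRigidity Ω = -2 * sInf (TSet Ω) := by
  unfold torsionalRigidity TSet Adm
  simp only [and_assoc]

lemma lambda_eq (Ω : Set EE) : dirichletEigenvalue1 Ω = sInf (LSet Ω) := by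
  unfold dirichletEigenvalue1 LSet Adm
  simp only [and_assoc]

lemma adm_zero (Ω : Set EE) : Adm Ω (fun _ => 0) :=
  ⟨contDiff_const, HasCompactSupport.zero, by simp [tsupport]⟩

lemma zero_mem_TSet (Ω : Set EE) : (0 : ℝ) ∈ TSet Ω :=
  ⟨_, adm_zero Ω, by simp⟩

lemma Adm.mono {Ω Ω' : Set EE} (h : Ω ⊆ Ω') {u : EE → ℝ} (hu : Adm Ω u) : Adm Ω' u :=
  ⟨hu.1, hu.2.1, hu.2.2.trans h⟩

lemma Adm.int_u {Ω : Set EE} {u : EE → ℝ} (hu : Adm Ω u) : Integrable u :=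
  hu.1.continuous.integrable_of_hasCompactSupport hu.2.1

lemma Adm.int_sq {Ω : Set EE} {u : EE → ℝ} (hu : Adm Ω u) : Integrable (fun x => u x ^ 2) := by
  have h1 : Continuous (fun x => u x ^ 2) := hu.1.continuous.pow 2
  have h2 : HasCompactSupport (fun x => u x ^ 2) :=
    HasCompactSupport.intro hu.2.1
      (fun x hx => by simp [image_eq_zero_of_notMem_tsupport hx])
  exact h1.integrable_of_hasCompactSupport h2

lemma Adm.int_grad {Ω : Set EE} {u : EE → ℝ} (hu : Adm Ω u) :
    Integrable (fun x => ‖fderiv ℝ u x‖ ^ 2) := by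
  have h1 : Continuous (fun x => ‖fderiv ℝ u x‖ ^ 2) :=
    (hu.1.continuous_fderiv (by simp)).norm.pow 2
  have h2 : HasCompactSupport (fun x => ‖fderiv ℝ u x‖ ^ 2) :=
    HasCompactSupport.intro (hu.2.1.fderiv ℝ)
      (fun x hx => by simp [image_eq_zero_of_notMem_tsupport hx])
  exact h1.integrable_of_hasCompactSupport h2

lemma norm_sum_sq {ι F : Type*} [Fintype ι] [NormedAddCommGroup F] (a : ι → F)
    (h : ∀ i j, i ≠ j → a i = 0 ∨ a j = 0) : ‖∑ i, a i‖ ^ 2 = ∑ i, ‖a i‖ ^ 2 := by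
  by_cases H : ∃ i, a i ≠ 0
  · obtain ⟨i, hi⟩ := H
    have h0 : ∀ j, j ≠ i → a j = 0 := fun j hj => by
      rcases h j i hj with h | h
      · exact h
      · exact absurd h hi
    rw [Finset.sum_eq_single i (fun j _ hj => h0 j hj) (by simp),
      Finset.sum_eq_single i (fun j _ hj => by simp [h0 j hj]) (by simp)]
  · push Not at H
    simp [H]

section Union
variable {ι : Type*} [Fintype ι] {U : ι → Set (EuclideanSpace ℝ (Fin d))}

lemma adm_sum {u : ι → EE → ℝ} (hu : ∀ i, Adm (U i) (u i)) :
    Adm (⋃ i, U i) (fun x => ∑ i, u i x) := by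
  have hsub : Function.support (fun x => ∑ i, u i x) ⊆ ⋃ i, tsupport (u i) := by
    intro x hx
    by_contra hc
    simp only [mem_iUnion, not_exists] at hc
    exact hx (Finset.sum_eq_zero fun i _ => image_eq_zero_of_notMem_tsupport (hc i))
  have hcomp : IsCompact (⋃ i, tsupport (u i)) := isCompact_iUnion fun i => (hu i).2.1
  refine ⟨ContDiff.sum fun i _ => (hu i).1, HasCompactSupport.of_support_subset_isCompact hcomp hsub,
    ?_⟩
  exact (closure_minimal hsub hcomp.isClosed).trans (iUnion_mono fun i => (hu i).2.2)

lemma grad_sum (hU : ∀ i j, i ≠ j → Disjoint (U i) (U j)) {u : ι → EE → ℝ}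
    (hu : ∀ i, Adm (U i) (u i)) (x : EE) :
    ‖fderiv ℝ (fun x => ∑ i, u i x) x‖ ^ 2 = ∑ i, ‖fderiv ℝ (u i) x‖ ^ 2 := by
  rw [fderiv_fun_sum fun i _ => ((hu i).1.differentiable (by simp)).differentiableAt]
  apply norm_sum_sq
  intro i j hij
  by_contra! hc
  have h1 : x ∈ tsupport (u i) := support_fderiv_subset ℝ hc.1
  have h2 : x ∈ tsupport (u j) := support_fderiv_subset ℝ hc.2
  exact Set.disjoint_left.1 (hU i j hij) ((hu i).2.2 h1) ((hu j).2.2 h2)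

lemma sq_sum (hU : ∀ i j, i ≠ j → Disjoint (U i) (U j)) {u : ι → EE → ℝ}
    (hu : ∀ i, Adm (U i) (u i)) (x : EE) :
    (∑ i, u i x) ^ 2 = ∑ i, u i x ^ 2 := by
  have := norm_sum_sq (fun i => u i x) ?_
  · simpa using this
  intro i j hij
  by_contra! hc
  exact Set.disjoint_left.1 (hU i j hij) ((hu i).2.2 (subset_tsupport _ hc.1))
    ((hu j).2.2 (subset_tsupport _ hc.2))

lemma adm_decomp (hU : ∀ i j, i ≠ j → Disjoint (U i) (U j)) (hO : ∀ i, IsOpen (U i)) {v : EE → ℝ}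
    (hv : Adm (⋃ i, U i) v) :
    ∃ u : ι → EE → ℝ, (∀ i, Adm (U i) (u i)) ∧ v = fun x => ∑ i, u i x := by
  classical
  refine ⟨fun i => (U i).indicator v, fun i => ?_, ?_⟩
  · have hK : tsupport v ∩ U i = tsupport v ∩ (⋃ j ∈ {j | j ≠ i}, U j)ᶜ := by
      ext x
      simp only [mem_inter_iff, mem_compl_iff, mem_iUnion, mem_ofPred_eq, not_exists]
      refine and_congr_right fun hx => ⟨fun hi j hj hxj => ?_, fun h => ?_⟩
      · exact (hU j i hj).le_bot ⟨hxj, hi⟩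
      · obtain ⟨j, hj⟩ := mem_iUnion.1 (hv.2.2 hx)
        by_cases hji : j = i
        · exact hji ▸ hj
        · exact absurd hj (h j hji)
    have hC : IsClosed (tsupport v ∩ U i) := by
      rw [hK]
      exact (isClosed_tsupport v).inter (isOpen_biUnion fun j _ => hO j).isClosed_compl
    have hcomp : IsCompact (tsupport v ∩ U i) :=
      IsCompact.of_isClosed_subset hv.2.1 hC inter_subset_left
    have hsub : Function.support ((U i).indicator v) ⊆ tsupport v ∩ U i := by
      intro x hx
      rw [Function.mem_support, Set.indicator_apply_ne_zero] at hx
      exact ⟨subset_tsupport _ hx.2, hx.1⟩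
    refine ⟨?_, HasCompactSupport.of_support_subset_isCompact hcomp hsub,
      (closure_minimal hsub hC).trans inter_subset_right⟩
    rw [contDiff_iff_contDiffAt]
    intro x
    by_cases hx : x ∈ U i
    · refine hv.1.contDiffAt.congr_of_eventuallyEq ?_
      filter_upwards [(hO i).mem_nhds hx] with y hy
      exact indicator_of_mem hy v
    · refine (contDiffAt_const (c := (0 : ℝ))).congr_of_eventuallyEq ?_
      filter_upwards [hC.isOpen_compl.mem_nhds (x := x) (fun h => hx h.2)] with y hy
      by_contra hc
      exact hy (hsub hc)
  · funext x
    by_cases hx : ∃ i, x ∈ U i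
    · obtain ⟨i, hi⟩ := hx
      rw [Finset.sum_eq_single i]
      · exact (indicator_of_mem hi v).symm
      · intro j _ hj
        exact indicator_of_notMem (fun h => (hU j i hj).le_bot ⟨h, hi⟩) v
      · simp
    · push Not at hx
      rw [Finset.sum_eq_zero fun i _ => indicator_of_notMem (hx i) v]
      apply image_eq_zero_of_notMem_tsupport
      intro h
      obtain ⟨j, hj⟩ := mem_iUnion.1 (hv.2.2 h)
      exact hx j hj

lemma J_sum (hU : ∀ i j, i ≠ j → Disjoint (U i) (U j)) {u : ι → EE → ℝ}
    (hu : ∀ i, Adm (U i) (u i)) :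
    ∫ x, (‖fderiv ℝ (fun x => ∑ i, u i x) x‖ ^ 2 / 2 - ∑ i, u i x) =
      ∑ i, ∫ x, (‖fderiv ℝ (u i) x‖ ^ 2 / 2 - u i x) := by
  have hi : ∀ i ∈ Finset.univ, Integrable (fun x => ‖fderiv ℝ (u i) x‖ ^ 2 / 2 - u i x) :=
    fun i _ => ((hu i).int_grad.div_const 2).sub (hu i).int_u
  rw [← integral_finsetSum _ hi]
  congr 1 with x
  rw [grad_sum hU hu, Finset.sum_sub_distrib, Finset.sum_div]

lemma TSet_union (hU : ∀ i j, i ≠ j → Disjoint (U i) (U j)) (hO : ∀ i, IsOpen (U i)) (r : ℝ) :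
    r ∈ TSet (⋃ i, U i) ↔ ∃ s : ι → ℝ, (∀ i, s i ∈ TSet (U i)) ∧ r = ∑ i, s i := by
  constructor
  · rintro ⟨v, hv, rfl⟩
    obtain ⟨u, hu, rfl⟩ := adm_decomp hU hO hv
    exact ⟨_, fun i => ⟨u i, hu i, rfl⟩, J_sum hU hu⟩
  · rintro ⟨s, hs, rfl⟩
    choose u hu hs using hs
    refine ⟨_, adm_sum hu, ?_⟩
    rw [J_sum hU hu]
    simp [hs]

lemma LSet_union_lb (hU : ∀ i j, i ≠ j → Disjoint (U i) (U j)) (hO : ∀ i, IsOpen (U i)) {m r : ℝ}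
    (hm : ∀ i, m ≤ sInf (LSet (U i))) (hr : r ∈ LSet (⋃ i, U i)) : m ≤ r := by
  obtain ⟨v, hv, h0, rfl⟩ := hr
  have hpos : 0 < ∫ x, v x ^ 2 := lt_of_le_of_ne (integral_nonneg fun x => sq_nonneg _) h0.symm
  rw [le_div_iff₀ hpos]
  clear hpos h0
  obtain ⟨u, hu, rfl⟩ := adm_decomp hU hO hv
  simp_rw [sq_sum hU hu, grad_sum hU hu]
  rw [integral_finsetSum _ fun i _ => (hu i).int_sq,
    integral_finsetSum _ fun i _ => (hu i).int_grad, Finset.mul_sum]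
  refine Finset.sum_le_sum fun i _ => ?_
  by_cases h : ∫ x, u i x ^ 2 = 0
  · rw [h, mul_zero]
    exact integral_nonneg fun x => sq_nonneg _
  · have hpos : 0 < ∫ x, u i x ^ 2 :=
      lt_of_le_of_ne (integral_nonneg fun x => sq_nonneg _) (Ne.symm h)
    rw [← le_div_iff₀ hpos]
    refine (hm i).trans (csInf_le ⟨0, ?_⟩ ⟨u i, hu i, h, rfl⟩)
    rintro _ ⟨w, _, _, rfl⟩
    exact div_nonneg (integral_nonneg fun x => sq_nonneg _) (integral_nonneg fun x => sq_nonneg _)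

end Union

lemma LSet_nonneg {Ω : Set EE} {r : ℝ} (hr : r ∈ LSet Ω) : 0 ≤ r := by
  obtain ⟨w, _, _, rfl⟩ := hr
  exact div_nonneg (integral_nonneg fun x => sq_nonneg _) (integral_nonneg fun x => sq_nonneg _)

lemma LSet_nonempty (c : EE) {R : ℝ} (hR : 0 < R) : (LSet (ball c R)).Nonempty := by
  let f : ContDiffBump c := ⟨R / 4, R / 2, by linarith, by linarith⟩
  have hf : Adm (ball c R) f := by
    refine ⟨f.contDiff, f.hasCompactSupport, ?_⟩
    rw [f.tsupport_eq]
    exact closedBall_subset_ball (by simp [f]; linarith)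
  refine ⟨_, f, hf, ?_, rfl⟩
  have h1 : Continuous (fun x => f x ^ 2) := f.continuous.pow 2
  have h2 : HasCompactSupport (fun x => f x ^ 2) :=
    HasCompactSupport.intro f.hasCompactSupport
      (fun x hx => by simp [image_eq_zero_of_notMem_tsupport hx])
  have h3 : f c = 1 := f.one_of_mem_closedBall (mem_closedBall_self (by simp [f]; linarith))
  exact ne_of_gt (h1.integral_pos_of_hasCompactSupport_nonneg_nonzero h2 (fun x => sq_nonneg _) (x := c)
    (by simp [h3]))

/-- Rescaling. -/
noncomputable def resc (a b : EuclideanSpace ℝ (Fin d)) (k : ℝ) (u : EuclideanSpace ℝ (Fin d) → ℝ) :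
    EuclideanSpace ℝ (Fin d) → ℝ := fun x => k ^ 2 * u (a + k⁻¹ • (x - b))

lemma int_resc (a b : EE) {k : ℝ} (hk : 0 < k) (f : EE → ℝ) :
    ∫ x, f (a + k⁻¹ • (x - b)) = k ^ d * ∫ x, f x := by
  rw [integral_sub_right_eq_self (fun x => f (a + k⁻¹ • x)) b,
    Measure.integral_comp_smul volume (fun x => f (a + x)) k⁻¹,
    integral_add_left_eq_self f a]
  simp [abs_of_pos hk]

lemma fderiv_resc (a b : EE) {k : ℝ} (hk : 0 < k) {u : EE → ℝ} (hu : ContDiff ℝ 1 u) (x : EE) :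
    ‖fderiv ℝ (resc a b k u) x‖ ^ 2 = k ^ 2 * ‖fderiv ℝ u (a + k⁻¹ • (x - b))‖ ^ 2 := by
  have h1 : HasFDerivAt (fun x : EE => a + k⁻¹ • (x - b)) (k⁻¹ • ContinuousLinearMap.id ℝ EE) x :=
    (((hasFDerivAt_id x).sub_const b).const_smul k⁻¹).const_add a
  have h2 := ((hu.differentiable (by simp) (a + k⁻¹ • (x - b))).hasFDerivAt.comp x h1).const_mul
    (k ^ 2)
  have h3 : fderiv ℝ (resc a b k u) x = k • fderiv ℝ u (a + k⁻¹ • (x - b)) := by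
    refine HasFDerivAt.fderiv (h2.congr_fderiv ?_)
    ext y
    simp
    field_simp
  rw [h3, norm_smul, mul_pow]
  simp

lemma adm_resc (a b : EE) {k r : ℝ} (hk : 0 < k) {u : EE → ℝ} (hu : Adm (ball a r) u) :
    Adm (ball b (k * r)) (resc a b k u) := by
  have hsub : Function.support (resc a b k u) ⊆ (fun y => b + k • (y - a)) '' tsupport u := by
    intro x hx
    refine ⟨a + k⁻¹ • (x - b), subset_tsupport _ ?_, ?_⟩
    · intro h
      exact hx (by simp [resc, h])
    · simp [smul_smul, hk.ne']
  have hcomp : IsCompact ((fun y => b + k • (y - a)) '' tsupport u) :=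
    IsCompact.image hu.2.1 (by fun_prop)
  refine ⟨?_, HasCompactSupport.of_support_subset_isCompact hcomp hsub,
    (closure_minimal hsub hcomp.isClosed).trans ?_⟩
  · have := hu.1
    unfold resc
    fun_prop
  · rintro _ ⟨y, hy, rfl⟩
    have := hu.2.2 hy
    rw [mem_ball, dist_eq_norm] at this ⊢
    simp only [add_sub_cancel_left, norm_smul, Real.norm_eq_abs, abs_of_pos hk]
    gcongr

lemma TSet_resc (a b : EE) {k r s : ℝ} (hk : 0 < k) (hs : s ∈ TSet (ball a r)) :
    k ^ (d + 2) * s ∈ TSet (ball b (k * r)) := by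
  obtain ⟨u, hu, rfl⟩ := hs
  refine ⟨_, adm_resc a b hk hu, ?_⟩
  rw [pow_add, mul_right_comm, ← int_resc a b hk, mul_comm, ← integral_const_mul]
  congr 1 with x
  rw [fderiv_resc a b hk hu.1, resc]
  ring

lemma LSet_resc (a b : EE) {k r s : ℝ} (hk : 0 < k) (hs : s ∈ LSet (ball a r)) :
    (k ^ 2)⁻¹ * s ∈ LSet (ball b (k * r)) := by
  obtain ⟨u, hu, h0, rfl⟩ := hs
  have h1 : ∫ x, resc a b k u x ^ 2 = k ^ 4 * (k ^ d * ∫ x, u x ^ 2) := by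
    rw [← int_resc a b hk (fun x => u x ^ 2), ← integral_const_mul]
    congr 1 with x
    rw [resc]; ring
  have h2 : ∫ x, ‖fderiv ℝ (resc a b k u) x‖ ^ 2 = k ^ 2 * (k ^ d * ∫ x, ‖fderiv ℝ u x‖ ^ 2) := by
    rw [← int_resc a b hk (fun x => ‖fderiv ℝ u x‖ ^ 2), ← integral_const_mul]
    congr 1 with x
    rw [fderiv_resc a b hk hu.1]
  refine ⟨_, adm_resc a b hk hu, ?_, ?_⟩
  · rw [h1]; positivity
  · rw [h1, h2]; field_simp

lemma TSet_ball (c : EE) {R : ℝ} (hR : 0 < R) (s : ℝ) :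
    s ∈ TSet (ball c R) ↔ ∃ t ∈ TSet (ball (0 : EE) 1), s = R ^ (d + 2) * t := by
  constructor
  · intro h
    refine ⟨_, by simpa [hR.ne'] using TSet_resc c 0 (inv_pos.2 hR) h, ?_⟩
    field_simp
  · rintro ⟨t, ht, rfl⟩
    simpa using TSet_resc 0 c hR ht

open scoped Pointwise in
lemma lambda_ball (c : EE) {R : ℝ} (hR : 0 < R) :
    sInf (LSet (ball c R)) = (R ^ 2)⁻¹ * sInf (LSet (ball (0 : EE) 1)) := by
  have : LSet (ball c R) = (fun t => (R ^ 2)⁻¹ * t) '' LSet (ball (0 : EE) 1) := by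
    ext s
    rw [Set.mem_image]
    constructor
    · intro h
      refine ⟨_, by simpa [hR.ne'] using LSet_resc c 0 (inv_pos.2 hR) h, ?_⟩
      field_simp
    · rintro ⟨t, ht, rfl⟩
      simpa using LSet_resc 0 c hR ht
  have h2 := Real.sInf_smul_of_nonneg (a := (R ^ 2)⁻¹) (by positivity) (LSet (ball (0 : EE) 1))
  rw [this]
  exact h2

section Balls
variable {ι : Type*} [Fintype ι]

lemma torsion_union (c : ι → EE) {R : ι → ℝ} (hR : ∀ i, 0 < R i)
    (hU : ∀ i j, i ≠ j → Disjoint (ball (c i) (R i)) (ball (c j) (R j))) [Nonempty ι] :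
    torsionalRigidity (⋃ i, ball (c i) (R i)) =
      (∑ i, R i ^ (d + 2)) * torsionalRigidity (ball (0 : EE) 1) := by
  classical
  rw [torsion_eq, torsion_eq, mul_left_comm]
  congr 1
  set S := TSet (ball (0 : EE) 1) with hS
  have key : ∀ r, r ∈ TSet (⋃ i, ball (c i) (R i)) ↔
      ∃ t : ι → ℝ, (∀ i, t i ∈ S) ∧ r = ∑ i, R i ^ (d + 2) * t i := by
    intro r
    rw [TSet_union hU fun i => isOpen_ball]
    constructor
    · rintro ⟨s, hs, rfl⟩
      choose t ht hst using fun i => (TSet_ball (c i) (hR i) (s i)).1 (hs i)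
      exact ⟨t, ht, by simp [hst]⟩
    · rintro ⟨t, ht, rfl⟩
      exact ⟨_, fun i => (TSet_ball (c i) (hR i) _).2 ⟨t i, ht i, rfl⟩, rfl⟩
  have hpos : 0 < ∑ i, R i ^ (d + 2) :=
    Finset.sum_pos (fun i _ => pow_pos (hR i) _) Finset.univ_nonempty
  have key2 : ∀ t ∈ S, (∑ i, R i ^ (d + 2)) * t ∈ TSet (⋃ i, ball (c i) (R i)) := fun t ht =>
    (key _).2 ⟨fun _ => t, fun _ => ht, by rw [Finset.sum_mul]⟩
  by_cases hb : BddBelow S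
  · have hlb : (∑ i, R i ^ (d + 2)) * sInf S ∈ lowerBounds (TSet (⋃ i, ball (c i) (R i))) := by
      intro r hr
      obtain ⟨t, ht, rfl⟩ := (key r).1 hr
      rw [Finset.sum_mul]
      refine Finset.sum_le_sum fun i _ => ?_
      have := (hR i).le
      have := csInf_le hb (ht i)
      gcongr
    apply le_antisymm
    · rw [mul_comm, ← div_le_iff₀ hpos]
      refine le_csInf ⟨0, zero_mem_TSet _⟩ fun t ht => ?_
      rw [div_le_iff₀ hpos, mul_comm]
      exact csInf_le ⟨_, hlb⟩ (key2 t ht)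
    · exact le_csInf ⟨0, zero_mem_TSet _⟩ hlb
  · rw [Real.sInf_of_not_bddBelow hb, mul_zero]
    apply Real.sInf_of_not_bddBelow
    rintro ⟨m, hm⟩
    refine hb ⟨m / ∑ i, R i ^ (d + 2), fun t ht => ?_⟩
    rw [div_le_iff₀ hpos, mul_comm]
    exact hm (key2 t ht)

lemma lambda_union (c : ι → EE) {R : ι → ℝ} (hR : ∀ i, 0 < R i)
    (hU : ∀ i j, i ≠ j → Disjoint (ball (c i) (R i)) (ball (c j) (R j))) (i₀ : ι)
    (hmax : ∀ i, R i ≤ R i₀) :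
    dirichletEigenvalue1 (⋃ i, ball (c i) (R i)) =
      (R i₀ ^ 2)⁻¹ * dirichletEigenvalue1 (ball (0 : EE) 1) := by
  rw [lambda_eq, lambda_eq, ← lambda_ball (c i₀) (hR i₀)]
  have hsub : LSet (ball (c i₀) (R i₀)) ⊆ LSet (⋃ i, ball (c i) (R i)) := by
    rintro _ ⟨u, hu, h⟩
    exact ⟨u, hu.mono (subset_iUnion (fun i => ball (c i) (R i)) i₀), h⟩
  have hne := LSet_nonempty (c i₀) (hR i₀)
  apply le_antisymm
  · exact csInf_le_csInf ⟨0, fun r hr => LSet_nonneg hr⟩ hne hsub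
  · refine le_csInf (hne.mono hsub) fun r hr =>
      LSet_union_lb hU (fun i => isOpen_ball) (fun i => ?_) hr
    rw [lambda_ball _ (hR i₀), lambda_ball _ (hR i)]
    have h0 : 0 ≤ sInf (LSet (ball (0 : EE) 1)) := Real.sInf_nonneg fun r hr => LSet_nonneg hr
    have := hR i
    have := hmax i
    gcongr

end Balls

lemma prod_nonneg' (Ω : Set EE) : 0 ≤ dirichletEigenvalue1 Ω * torsionalRigidity Ω := by
  apply mul_nonneg
  · rw [lambda_eq]; exact Real.sInf_nonneg fun r hr => LSet_nonneg hr
  · rw [torsion_eq]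
    have : sInf (TSet Ω) ≤ 0 := by
      by_cases hb : BddBelow (TSet Ω)
      · exact csInf_le hb (zero_mem_TSet _)
      · exact (Real.sInf_of_not_bddBelow hb).le
    linarith

lemma tail_tendsto (hd : 0 < d) : Filter.Tendsto (fun n : ℕ =>
    (((n : ℝ) ^ ((2 : ℝ) / d) + n - 1) / (n : ℝ) ^ (1 + (2 : ℝ) / d))) Filter.atTop (nhds 0) := by
  have hp : (0 : ℝ) < 2 / d := by positivity
  have h1 : Filter.Tendsto (fun n : ℕ => ((n : ℝ))⁻¹) Filter.atTop (nhds 0) :=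
    tendsto_inv_atTop_nhds_zero_nat
  have h2 : Filter.Tendsto (fun n : ℕ => (n : ℝ) ^ (-((2 : ℝ) / d))) Filter.atTop (nhds 0) :=
    (tendsto_rpow_neg_atTop hp).comp tendsto_natCast_atTop_atTop
  have h3 : Filter.Tendsto (fun n : ℕ => ((n : ℝ))⁻¹ + (1 - (n : ℝ)⁻¹) * (n : ℝ) ^ (-((2 : ℝ) / d)))
      Filter.atTop (nhds (0 + (1 - 0) * 0)) := h1.add ((h1.const_sub 1).mul h2)
  simp only [mul_zero, add_zero] at h3
  refine h3.congr' ?_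
  filter_upwards [Filter.eventually_ge_atTop 1] with n hn
  have hn' : (0 : ℝ) < n := by exact_mod_cast hn
  rw [rpow_neg hn'.le, rpow_add hn', rpow_one]
  have : 0 < (n : ℝ) ^ ((2 : ℝ) / d) := rpow_pos_of_pos hn' _
  field_simp
  ring

lemma radius_pow (hd : 0 < d) {x : ℝ} (hx : 0 < x) : (x ^ (-(1 : ℝ) / d)) ^ d = x⁻¹ := by
  have hd' : (d : ℝ) ≠ 0 := by positivity
  rw [← rpow_natCast, ← rpow_mul hx.le, div_mul_cancel₀ _ hd', rpow_neg_one]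

lemma radius_sq {x : ℝ} (hx : 0 < x) :
    (x ^ (-(1 : ℝ) / d)) ^ 2 = (x ^ ((2 : ℝ) / d))⁻¹ := by
  rw [← rpow_natCast, ← rpow_mul hx.le, ← rpow_neg hx.le]
  congr 1
  push_cast
  ring

lemma main_part (hd : 0 < d) (n : ℕ) (hn : 1 ≤ n) (c₀ : EE) (c : Fin (n * (n - 1)) → EE)
    (ω Rn rn : ℝ) (hω : ω = (volume (ball (0 : EE) 1)).toReal)
    (hRn : Rn = ((n : ℝ) * ω) ^ (-(1 : ℝ) / d)) (hrn : rn = ((n : ℝ) ^ 2 * ω) ^ (-(1 : ℝ) / d))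
    (h0 : ∀ i, Disjoint (ball c₀ Rn) (ball (c i) rn))
    (hc : ∀ i j, i ≠ j → Disjoint (ball (c i) rn) (ball (c j) rn)) :
    volume (ball c₀ Rn ∪ ⋃ i, ball (c i) rn) = 1 ∧
      dirichletEigenvalue1 (ball c₀ Rn ∪ ⋃ i, ball (c i) rn) *
        torsionalRigidity (ball c₀ Rn ∪ ⋃ i, ball (c i) rn) =
        (dirichletEigenvalue1 (ball (0 : EE) 1) * torsionalRigidity (ball (0 : EE) 1) / ω) *
          (((n : ℝ) ^ ((2 : ℝ) / d) + n - 1) / (n : ℝ) ^ (1 + (2 : ℝ) / d)) := by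
  have hn' : (1 : ℝ) ≤ n := by exact_mod_cast hn
  have hnpos : (0 : ℝ) < n := by linarith
  have hωpos : 0 < ω := by
    rw [hω]
    exact ENNReal.toReal_pos (measure_ball_pos _ _ one_pos).ne' measure_ball_lt_top.ne
  have hRpos : 0 < Rn := by rw [hRn]; positivity
  have hrpos : 0 < rn := by rw [hrn]; positivity
  have hRd : Rn ^ d = ((n : ℝ) * ω)⁻¹ := by rw [hRn]; exact radius_pow hd (by positivity)
  have hrd : rn ^ d = ((n : ℝ) ^ 2 * ω)⁻¹ := by rw [hrn]; exact radius_pow hd (by positivity)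
  have hR2 : Rn ^ 2 = (((n : ℝ) * ω) ^ ((2 : ℝ) / d))⁻¹ := by
    rw [hRn]; exact radius_sq (by positivity)
  have hr2 : rn ^ 2 = (Rn ^ 2) * ((n : ℝ) ^ ((2 : ℝ) / d))⁻¹ := by
    rw [hR2, hrn, radius_sq (by positivity), ← mul_inv, ← mul_rpow (by positivity) (by positivity)]
    congr 2
    ring
  have hle : rn ≤ Rn := by
    refine le_of_pow_le_pow_left₀ hd.ne' hRpos.le ?_
    rw [hrd, hRd]
    gcongr
    nlinarith
  have hcard : ((n * (n - 1) : ℕ) : ℝ) = n * (n - 1) := by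
    push_cast [Nat.cast_sub hn]; ring
  let C : Option (Fin (n * (n - 1))) → EE := fun o => o.elim c₀ c
  let R : Option (Fin (n * (n - 1))) → ℝ := fun o => o.elim Rn (fun _ => rn)
  have hΩ : ball c₀ Rn ∪ ⋃ i, ball (c i) rn = ⋃ o, ball (C o) (R o) := by
    rw [Set.iUnion_option]
    rfl
  have hRp : ∀ o, 0 < R o := by rintro (_ | i) <;> simp [R, hRpos, hrpos]
  have hdis : ∀ i j, i ≠ j → Disjoint (ball (C i) (R i)) (ball (C j) (R j)) := by
    rintro (_ | i) (_ | j) hij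
    · exact absurd rfl hij
    · exact h0 j
    · exact (h0 i).symm
    · exact hc i j (fun h => hij (by rw [h]))
  have hsum : ∑ o, R o ^ (d + 2) = Rn ^ (d + 2) + n * (n - 1) * rn ^ (d + 2) := by
    rw [Fintype.sum_option]
    simp only [R, Option.elim, Finset.sum_const, Finset.card_univ, Fintype.card_fin, nsmul_eq_mul]
    rw [hcard]
  rw [hΩ]
  constructor
  · rw [measure_iUnion (fun i j hij => hdis i j hij) fun o => measurableSet_ball, tsum_fintype]
    have hv : ∀ o, volume (ball (C o) (R o)) = ENNReal.ofReal (R o ^ d * ω) := by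
      intro o
      rw [Measure.addHaar_ball_of_pos _ _ (hRp o), ENNReal.ofReal_mul (pow_nonneg (hRp o).le _), hω,
        ENNReal.ofReal_toReal measure_ball_lt_top.ne]
      simp
    simp_rw [hv]
    rw [← ENNReal.ofReal_sum_of_nonneg fun o _ => by have := hRp o; positivity,
      Fintype.sum_option]
    simp only [R, Option.elim, Finset.sum_const, Finset.card_univ, Fintype.card_fin, nsmul_eq_mul]
    rw [hcard, hRd, hrd, ← ENNReal.ofReal_one]
    congr 1
    field_simp
    ring
  · rw [lambda_union C hRp hdis none (by rintro (_ | i) <;> simp [R, hle]),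
      torsion_union C hRp hdis, hsum, pow_add, pow_add, hrd, hRd, hr2, rpow_add hnpos, rpow_one]
    have : 0 < (n : ℝ) ^ ((2 : ℝ) / d) := rpow_pos_of_pos hnpos _
    have hRe : R none = Rn := rfl
    rw [hRe]
    field_simp
    ring

lemma exists_centers (hd : 0 < d) (N : ℕ) {R r : ℝ} (hR : 0 < R) (hr : 0 < r) :
    ∃ (c₀ : EE) (c : Fin N → EE), (∀ i, Disjoint (ball c₀ R) (ball (c i) r)) ∧
      (∀ i j, i ≠ j → Disjoint (ball (c i) r) (ball (c j) r)) := by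
  let e : EE := EuclideanSpace.single ⟨0, hd⟩ 1
  have he : ‖e‖ = 1 := by simp [e]
  have hdist : ∀ a b : ℝ, dist (a • e) (b • e) = |a - b| := by
    intro a b
    rw [dist_eq_norm, ← sub_smul, norm_smul, he, mul_one, Real.norm_eq_abs]
  refine ⟨(0 : ℝ) • e, fun i => (((i : ℕ) + 1 : ℝ) * (2 * (R + r))) • e, fun i => ?_,
    fun i j hij => ?_⟩
  · apply ball_disjoint_ball
    rw [hdist, zero_sub, abs_neg, abs_of_nonneg (by positivity)]
    have : (0 : ℝ) ≤ (i : ℕ) := by positivity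
    nlinarith
  · apply ball_disjoint_ball
    rw [hdist, ← sub_mul, abs_mul, abs_of_pos (show 0 < 2 * (R + r) by positivity)]
    have h1 : (1 : ℝ) ≤ |((i : ℕ) + 1 : ℝ) - ((j : ℕ) + 1)| := by
      have : (1 : ℤ) ≤ |((i : ℕ) : ℤ) - ((j : ℕ) : ℤ)| := by
        apply Int.one_le_abs
        intro h
        apply hij
        ext
        omega
      rw [add_sub_add_right_eq_sub]
      exact_mod_cast this
    nlinarith

/-- Let `Ω_n ⊂ ℝ^d` be the disjoint union of one ball of volume `1/n` (radius
`(n ω_d)^(-1/d)`) and `n(n-1)` balls of volume `1/n²` (radius `(n² ω_d)^(-1/d)`).  Then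
`|Ω_n| = 1`,
`λ₁(Ω_n)·T(Ω_n) = (λ₁(B₁)T(B₁)/ω_d)·(n^(2/d) + n - 1)/n^(1+2/d)` which tends to `0`,
and hence the infimum of `λ₁(Ω)T(Ω)` over open sets of measure `1` is zero. -/
theorem inf_lambda1_mul_torsion_eq_zero (d : ℕ) (hd : 0 < d) :
    (∀ n : ℕ, 1 ≤ n →
      ∀ c₀ : EuclideanSpace ℝ (Fin d), ∀ c : Fin (n * (n - 1)) → EuclideanSpace ℝ (Fin d),
      let ω := (volume (ball (0 : EuclideanSpace ℝ (Fin d)) 1)).toReal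
      let Rn := ((n : ℝ) * ω) ^ (-(1 : ℝ) / d)
      let rn := ((n : ℝ) ^ 2 * ω) ^ (-(1 : ℝ) / d)
      let Ωn := ball c₀ Rn ∪ ⋃ i, ball (c i) rn
      (∀ i, Disjoint (ball c₀ Rn) (ball (c i) rn)) →
      (∀ i j, i ≠ j → Disjoint (ball (c i) rn) (ball (c j) rn)) →
      volume Ωn = 1 ∧
      dirichletEigenvalue1 Ωn * torsionalRigidity Ωn =
        (dirichletEigenvalue1 (ball (0 : EuclideanSpace ℝ (Fin d)) 1) *
            torsionalRigidity (ball (0 : EuclideanSpace ℝ (Fin d)) 1) / ω) *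
          (((n : ℝ) ^ ((2 : ℝ) / d) + n - 1) / (n : ℝ) ^ (1 + (2 : ℝ) / d))) ∧
    Filter.Tendsto (fun n : ℕ =>
        (dirichletEigenvalue1 (ball (0 : EuclideanSpace ℝ (Fin d)) 1) *
            torsionalRigidity (ball (0 : EuclideanSpace ℝ (Fin d)) 1) /
          (volume (ball (0 : EuclideanSpace ℝ (Fin d)) 1)).toReal) *
          (((n : ℝ) ^ ((2 : ℝ) / d) + n - 1) / (n : ℝ) ^ (1 + (2 : ℝ) / d)))
      Filter.atTop (nhds 0) ∧
    sInf {r : ℝ | ∃ Ω : Set (EuclideanSpace ℝ (Fin d)), IsOpen Ω ∧ volume Ω = 1 ∧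
        r = dirichletEigenvalue1 Ω * torsionalRigidity Ω} = 0 := by
  have hA : ∀ n : ℕ, 1 ≤ n → ∀ c₀ : EuclideanSpace ℝ (Fin d),
      ∀ c : Fin (n * (n - 1)) → EuclideanSpace ℝ (Fin d), _ :=
    fun n hn c₀ c => main_part hd n hn c₀ c _ _ _ rfl rfl rfl
  have hB : Filter.Tendsto (fun n : ℕ =>
        (dirichletEigenvalue1 (ball (0 : EuclideanSpace ℝ (Fin d)) 1) *
            torsionalRigidity (ball (0 : EuclideanSpace ℝ (Fin d)) 1) /
          (volume (ball (0 : EuclideanSpace ℝ (Fin d)) 1)).toReal) *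
          (((n : ℝ) ^ ((2 : ℝ) / d) + n - 1) / (n : ℝ) ^ (1 + (2 : ℝ) / d)))
      Filter.atTop (nhds 0) := by
    simpa using (tail_tendsto hd).const_mul
      (dirichletEigenvalue1 (ball (0 : EuclideanSpace ℝ (Fin d)) 1) *
            torsionalRigidity (ball (0 : EuclideanSpace ℝ (Fin d)) 1) /
          (volume (ball (0 : EuclideanSpace ℝ (Fin d)) 1)).toReal)
  refine ⟨hA, hB, ?_⟩
  apply le_antisymm
  · refine ge_of_tendsto hB ?_
    filter_upwards [Filter.eventually_ge_atTop 1] with n hn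
    have hnpos : (0 : ℝ) < n := by exact_mod_cast hn
    have hωpos : 0 < (volume (ball (0 : EuclideanSpace ℝ (Fin d)) 1)).toReal :=
      ENNReal.toReal_pos (measure_ball_pos _ _ one_pos).ne' measure_ball_lt_top.ne
    obtain ⟨c₀, c, h0, hc⟩ := exists_centers hd (n * (n - 1))
      (R := ((n : ℝ) * (volume (ball (0 : EuclideanSpace ℝ (Fin d)) 1)).toReal) ^ (-(1 : ℝ) / d))
      (r := ((n : ℝ) ^ 2 * (volume (ball (0 : EuclideanSpace ℝ (Fin d)) 1)).toReal)
        ^ (-(1 : ℝ) / d)) (by positivity) (by positivity)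
    obtain ⟨hv, hp⟩ := hA n hn c₀ c h0 hc
    refine csInf_le ⟨0, ?_⟩
      ⟨_, isOpen_ball.union (isOpen_iUnion fun i => isOpen_ball), hv, hp.symm⟩
    rintro _ ⟨Ω, _, _, rfl⟩
    exact prod_nonneg' Ω
  · apply Real.sInf_nonneg
    rintro _ ⟨Ω, _, _, rfl⟩
    exact prod_nonneg' Ω
end

section
/- For 0 < a ≤ b, the torsional rigidity of the rectangle R_{a,b} satisfies |T(R_{a,b}) - a³b/12 + 31ζ(5)a⁴/(2π⁵)| ≤ a⁵/(15b). -/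
open MeasureTheory Metric Set Real

abbrev E2 := EuclideanSpace ℝ (Fin 2)

lemma tr_norm_sq (L : E2 →L[ℝ] ℝ) : ‖L‖ ^ 2 =
    (L (EuclideanSpace.single 0 1)) ^ 2 + (L (EuclideanSpace.single 1 1)) ^ 2 := by
  obtain ⟨v, rfl⟩ := (InnerProductSpace.toDual ℝ E2).surjective L
  rw [LinearIsometryEquiv.norm_map, EuclideanSpace.norm_sq_eq]
  simp [Fin.sum_univ_two, EuclideanSpace.inner_single_right]

lemma tr_fubini (a b : ℝ) (ha : 0 < a) (hb : 0 < b) (f : ℝ → ℝ → ℝ)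
    (hf : Continuous (fun p : ℝ × ℝ => f p.1 p.2)) :
    ∫ x in {x : E2 | x 0 ∈ Ioo (-(b / 2)) (b / 2) ∧ x 1 ∈ Ioo (-(a / 2)) (a / 2)}, f (x 0) (x 1)
    = ∫ s in (-(b/2))..(b/2), ∫ t in (-(a/2))..(a/2), f s t := by
  have h1 := (volume_preserving_finTwoArrow ℝ).comp (PiLp.volume_preserving_ofLp (Fin 2))
  have hemb : MeasurableEmbedding
      ((MeasurableEquiv.finTwoArrow (α := ℝ)) ∘ (WithLp.ofLp : E2 → (Fin 2 → ℝ))) :=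
    (MeasurableEquiv.finTwoArrow (α := ℝ)).measurableEmbedding.comp
      (MeasurableEquiv.toLp 2 (Fin 2 → ℝ)).symm.measurableEmbedding
  have h2 := h1.setIntegral_preimage_emb hemb (fun p : ℝ × ℝ => f p.1 p.2)
    (Ioo (-(b / 2)) (b / 2) ×ˢ Ioo (-(a / 2)) (a / 2))
  have h3 : IntegrableOn (fun p : ℝ × ℝ => f p.1 p.2)
      (Ioo (-(b / 2)) (b / 2) ×ˢ Ioo (-(a / 2)) (a / 2)) (volume.prod volume) := by
    refine IntegrableOn.mono_set
      (hf.continuousOn.integrableOn_compact (isCompact_Icc.prod isCompact_Icc))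
      (prod_mono Ioo_subset_Icc_self Ioo_subset_Icc_self)
  rw [intervalIntegral.integral_of_le (by linarith), integral_Ioc_eq_integral_Ioo]
  simp_rw [intervalIntegral.integral_of_le (show -(a/2) ≤ a/2 by linarith), integral_Ioc_eq_integral_Ioo]
  rw [← setIntegral_prod _ h3]
  exact h2

lemma tr_cos_int (c a : ℝ) (hc : c ≠ 0) :
    ∫ y in (-(a/2))..(a/2), Real.cos (c * y) = 2 * Real.sin (c * a / 2) / c := by
  rw [intervalIntegral.integral_comp_mul_left _ hc, integral_cos]
  rw [mul_neg, Real.sin_neg, smul_eq_mul]; field_simp; ring_nf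

lemma tr_cosh_int (c a : ℝ) (hc : c ≠ 0) :
    ∫ y in (-(a/2))..(a/2), Real.cosh (c * y) = 2 * Real.sinh (c * a / 2) / c := by
  have : ∀ y ∈ uIcc (-(a/2)) (a/2), HasDerivAt (fun y => Real.sinh (c*y)/c) (Real.cosh (c * y)) y := by
    intro y _
    have := (((hasDerivAt_id y).const_mul c).sinh).div_const c
    simpa [hc] using this
  rw [intervalIntegral.integral_eq_sub_of_hasDerivAt this
    (Continuous.intervalIntegrable (by fun_prop) _ _)]
  rw [mul_neg, Real.sinh_neg]; field_simp; ring_nf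

noncomputable def kap (a : ℝ) (k : ℕ) : ℝ := (2 * k + 1) * π / a

lemma kap_pos (a : ℝ) (ha : 0 < a) (k : ℕ) : 0 < kap a k := by
  unfold kap; positivity

lemma tr_sin_half (a : ℝ) (ha : 0 < a) (k : ℕ) : Real.sin (kap a k * a / 2) = (-1) ^ k := by
  have : kap a k * a / 2 = π / 2 + k * π := by unfold kap; field_simp; ring
  rw [this, Real.sin_add_nat_mul_pi]; simp

lemma tr_cos_half (a : ℝ) (ha : 0 < a) (k : ℕ) : Real.cos (kap a k * a / 2) = 0 := by
  have : kap a k * a / 2 = π / 2 + k * π := by unfold kap; field_simp; ring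
  rw [this, Real.cos_add_nat_mul_pi]; simp

lemma tr_cos1 (a : ℝ) (ha : 0 < a) (k : ℕ) :
    ∫ y in (-(a/2))..(a/2), Real.cos (kap a k * y) = 2 * (-1) ^ k / kap a k := by
  rw [tr_cos_int _ _ (kap_pos a ha k).ne', tr_sin_half a ha]

lemma tr_ysin (a : ℝ) (ha : 0 < a) (k : ℕ) :
    ∫ y in (-(a/2))..(a/2), y * Real.sin (kap a k * y) = 2 * (-1) ^ k / kap a k ^ 2 := by
  have hc := (kap_pos a ha k).ne'
  set c := kap a k with hcd
  have : ∀ y ∈ uIcc (-(a/2)) (a/2), HasDerivAt (fun y => Real.sin (c*y)/c^2 - y * Real.cos (c*y)/c)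
      (y * Real.sin (c * y)) y := by
    intro y _
    have h0 := (hasDerivAt_id y).const_mul c
    have := ((h0.sin).div_const (c^2)).sub (((hasDerivAt_id y).mul h0.cos).div_const c)
    refine this.congr_deriv ?_
    simp only [id]; field_simp; ring
  rw [intervalIntegral.integral_eq_sub_of_hasDerivAt this
    (Continuous.intervalIntegrable (by fun_prop) _ _)]
  have e : c * (a/2) = c * a / 2 := by ring
  rw [mul_neg, Real.sin_neg, Real.cos_neg, e, tr_sin_half a ha, tr_cos_half a ha]; ring

lemma tr_orth (a : ℝ) (ha : 0 < a) (k l : ℕ) :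
    (∫ y in (-(a/2))..(a/2), Real.cos (kap a k * y) * Real.cos (kap a l * y)) =
      (if k = l then a / 2 else 0) ∧
    (∫ y in (-(a/2))..(a/2), Real.sin (kap a k * y) * Real.sin (kap a l * y)) =
      (if k = l then a / 2 else 0) := by
  have hp : ∫ y in (-(a/2))..(a/2), Real.cos ((kap a k + kap a l) * y) = 0 := by
    rw [tr_cos_int _ _ (by have := kap_pos a ha k; have := kap_pos a ha l; positivity)]
    have : (kap a k + kap a l) * a / 2 = ((k + l + 1 : ℕ) : ℝ) * π := by
      unfold kap; field_simp; push_cast; ring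
    rw [this, Real.sin_nat_mul_pi]; simp
  have hm : ∫ y in (-(a/2))..(a/2), Real.cos ((kap a k - kap a l) * y) = if k = l then a else 0 := by
    split_ifs with h
    · subst h; simp
    · have hne : kap a k - kap a l ≠ 0 := by
        have : kap a k - kap a l = 2 * π / a * ((k:ℝ) - l) := by unfold kap; field_simp; ring
        rw [this]
        have h' : (k:ℝ) - l ≠ 0 := sub_ne_zero.2 (by exact_mod_cast h)
        have := Real.pi_pos
        positivity
      rw [tr_cos_int _ _ hne]
      have : (kap a k - kap a l) * a / 2 = (((k:ℤ) - l : ℤ) : ℝ) * π := by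
        unfold kap; field_simp; push_cast; ring
      rw [this, Real.sin_int_mul_pi]; simp
  have i1 : IntervalIntegrable (fun y => Real.cos ((kap a k - kap a l) * y)) volume (-(a/2)) (a/2) :=
    Continuous.intervalIntegrable (by fun_prop) _ _
  have i2 : IntervalIntegrable (fun y => Real.cos ((kap a k + kap a l) * y)) volume (-(a/2)) (a/2) :=
    Continuous.intervalIntegrable (by fun_prop) _ _
  constructor
  · have : (fun y => Real.cos (kap a k * y) * Real.cos (kap a l * y)) =
      fun y => (1/2) * (Real.cos ((kap a k - kap a l) * y) + Real.cos ((kap a k + kap a l) * y)) := by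
      ext y; rw [sub_mul, add_mul, Real.cos_sub, Real.cos_add]; ring
    rw [this, intervalIntegral.integral_const_mul, intervalIntegral.integral_add i1 i2, hp, hm]
    split_ifs <;> ring
  · have : (fun y => Real.sin (kap a k * y) * Real.sin (kap a l * y)) =
      fun y => (1/2) * (Real.cos ((kap a k - kap a l) * y) - Real.cos ((kap a k + kap a l) * y)) := by
      ext y; rw [sub_mul, add_mul, Real.cos_sub, Real.cos_add]; ring
    rw [this, intervalIntegral.integral_const_mul, intervalIntegral.integral_sub i1 i2, hp, hm]
    split_ifs <;> ring

lemma tr_orth_sum (a : ℝ) (N : ℕ) (S : ℕ → ℝ → ℝ) (hS : ∀ k, Continuous (S k))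
    (h : ∀ k l, ∫ y in (-(a/2))..(a/2), S k y * S l y = if k = l then a / 2 else 0) (A : ℕ → ℝ) :
    ∫ y in (-(a/2))..(a/2), (∑ k ∈ Finset.range N, A k * S k y) ^ 2 =
      ∑ k ∈ Finset.range N, a / 2 * A k ^ 2 := by
  have : (fun y => (∑ k ∈ Finset.range N, A k * S k y) ^ 2) = fun y =>
      ∑ k ∈ Finset.range N, ∑ l ∈ Finset.range N, A k * A l * (S k y * S l y) := by
    ext y; rw [sq, Finset.sum_mul_sum]
    refine Finset.sum_congr rfl fun k _ => Finset.sum_congr rfl fun l _ => by ring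
  rw [this, intervalIntegral.integral_finsetSum]
  · refine Finset.sum_congr rfl fun k hk => ?_
    rw [intervalIntegral.integral_finsetSum]
    · simp_rw [intervalIntegral.integral_const_mul, h]
      simp [Finset.mem_range.1 hk]; ring
    · intro l _; exact Continuous.intervalIntegrable (by fun_prop) _ _
  · intro l _; exact Continuous.intervalIntegrable (by fun_prop) _ _

/-- inner integral for the lower bound -/
lemma tr_inner_low (a : ℝ) (ha : 0 < a) (N : ℕ) (A B G : ℕ → ℝ) :
    ∫ y in (-(a/2))..(a/2), (((∑ k ∈ Finset.range N, A k * Real.cos (kap a k * y)) ^ 2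
      + (∑ k ∈ Finset.range N, B k * Real.sin (kap a k * y)) ^ 2) / 2
      - ∑ k ∈ Finset.range N, G k * Real.cos (kap a k * y))
    = ∑ k ∈ Finset.range N, (a / 4 * (A k ^ 2 + B k ^ 2) - G k * (2 * (-1) ^ k / kap a k)) := by
  rw [intervalIntegral.integral_sub (Continuous.intervalIntegrable (by fun_prop) _ _)
    (Continuous.intervalIntegrable (by fun_prop) _ _), intervalIntegral.integral_div,
    intervalIntegral.integral_add (Continuous.intervalIntegrable (by fun_prop) _ _)
    (Continuous.intervalIntegrable (by fun_prop) _ _),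
    tr_orth_sum a N (fun k y => Real.cos (kap a k * y)) (by fun_prop) (fun k l => (tr_orth a ha k l).1),
    tr_orth_sum a N (fun k y => Real.sin (kap a k * y)) (by fun_prop) (fun k l => (tr_orth a ha k l).2),
    intervalIntegral.integral_finsetSum]
  · simp_rw [intervalIntegral.integral_const_mul, tr_cos1 a ha]
    rw [← Finset.sum_add_distrib, Finset.sum_div, ← Finset.sum_sub_distrib]
    refine Finset.sum_congr rfl fun k hk => by ring
  · intro l _; exact Continuous.intervalIntegrable (by fun_prop) _ _

/-- inner integral for the upper bound -/
lemma tr_inner_up (a : ℝ) (ha : 0 < a) (N : ℕ) (A B : ℕ → ℝ) :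
    ∫ y in (-(a/2))..(a/2), ((∑ k ∈ Finset.range N, A k * Real.cos (kap a k * y)) ^ 2
      + (- y + ∑ k ∈ Finset.range N, B k * Real.sin (kap a k * y)) ^ 2)
    = a ^ 3 / 12 + ∑ k ∈ Finset.range N,
      (a / 2 * (A k ^ 2 + B k ^ 2) - 2 * B k * (2 * (-1) ^ k / kap a k ^ 2)) := by
  have : (fun y => ((∑ k ∈ Finset.range N, A k * Real.cos (kap a k * y)) ^ 2
      + (- y + ∑ k ∈ Finset.range N, B k * Real.sin (kap a k * y)) ^ 2)) = fun y =>
      ((∑ k ∈ Finset.range N, A k * Real.cos (kap a k * y)) ^ 2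
      + (∑ k ∈ Finset.range N, B k * Real.sin (kap a k * y)) ^ 2) + (y ^ 2 -
      ∑ k ∈ Finset.range N, 2 * B k * (y * Real.sin (kap a k * y))) := by
    ext y
    have : ∑ k ∈ Finset.range N, 2 * B k * (y * Real.sin (kap a k * y)) =
      2 * y * ∑ k ∈ Finset.range N, B k * Real.sin (kap a k * y) := by
      rw [Finset.mul_sum]; refine Finset.sum_congr rfl fun k hk => by ring
    rw [this]; ring
  rw [this, intervalIntegral.integral_add (Continuous.intervalIntegrable (by fun_prop) _ _)
    (Continuous.intervalIntegrable (by fun_prop) _ _),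
    intervalIntegral.integral_sub (Continuous.intervalIntegrable (by fun_prop) _ _)
    (Continuous.intervalIntegrable (by fun_prop) _ _),
    intervalIntegral.integral_add (Continuous.intervalIntegrable (by fun_prop) _ _)
    (Continuous.intervalIntegrable (by fun_prop) _ _),
    tr_orth_sum a N (fun k y => Real.cos (kap a k * y)) (by fun_prop) (fun k l => (tr_orth a ha k l).1),
    tr_orth_sum a N (fun k y => Real.sin (kap a k * y)) (by fun_prop) (fun k l => (tr_orth a ha k l).2),
    intervalIntegral.integral_finsetSum]
  · simp_rw [intervalIntegral.integral_const_mul, tr_ysin a ha]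
    rw [integral_pow, Finset.sum_sub_distrib, ← Finset.sum_add_distrib]
    simp_rw [mul_add]
    push_cast
    ring
  · intro l _; exact Continuous.intervalIntegrable (by fun_prop) _ _
lemma tr_upper (Ω : Set E2) (hΩ : IsOpen Ω) (F0 F1 : E2 → ℝ) (h0 : ContDiff ℝ 1 F0)
    (h1 : ContDiff ℝ 1 F1)
    (hdiv : ∀ x, fderiv ℝ F0 x (EuclideanSpace.single 0 1) +
      fderiv ℝ F1 x (EuclideanSpace.single 1 1) = -1)
    (hintg : IntegrableOn (fun x => F0 x ^ 2 + F1 x ^ 2) Ω)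
    (u : E2 → ℝ) (hu : ContDiff ℝ 1 u) (hc : HasCompactSupport u) (hs : tsupport u ⊆ Ω) :
    -(1/2) * ∫ x in Ω, (F0 x ^ 2 + F1 x ^ 2) ≤ ∫ x, (‖fderiv ℝ u x‖ ^ 2 / 2 - u x) := by
  have hcd : HasCompactSupport (fderiv ℝ u) := hc.fderiv ℝ
  have cu : Continuous (fderiv ℝ u) := hu.continuous_fderiv one_ne_zero
  have c0 : Continuous (fderiv ℝ F0) := h0.continuous_fderiv one_ne_zero
  have c1 : Continuous (fderiv ℝ F1) := h1.continuous_fderiv one_ne_zero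
  have hIu : Integrable u := hu.continuous.integrable_of_hasCompactSupport hc
  have supp1 : ∀ (F : E2 → ℝ) (v : E2), HasCompactSupport (fun x => F x * fderiv ℝ u x v) := by
    intro F v
    refine hcd.mono' (fun x hx => subset_tsupport _ ?_)
    intro h; apply hx; simp [h]
  have i1 : ∀ (F : E2 → ℝ) (v : E2), Continuous F → Integrable (fun x => F x * fderiv ℝ u x v) := by
    intro F v hF
    exact (by fun_prop : Continuous (fun x => F x * fderiv ℝ u x v)).integrable_of_hasCompactSupport
      (supp1 F v)
  have i2 : ∀ (F : E2 → ℝ), Continuous F → Integrable (fun x => F x * u x) := by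
    intro F hF
    exact (hF.mul hu.continuous).integrable_of_hasCompactSupport hc.mul_left
  have ibp : ∀ (F : E2 → ℝ) (v : E2), ContDiff ℝ 1 F →
      ∫ x, F x * fderiv ℝ u x v = - ∫ x, fderiv ℝ F x v * u x := by
    intro F v hF
    have := hF.continuous_fderiv one_ne_zero
    exact integral_mul_fderiv_eq_neg_fderiv_mul_of_integrable (i2 _ (by fun_prop))
      (i1 F v hF.continuous) (i2 F hF.continuous)
      (fun x _ => hF.differentiable one_ne_zero x) (fun x _ => hu.differentiable one_ne_zero x)
  have key : ∫ x, (F0 x * fderiv ℝ u x (EuclideanSpace.single 0 1) +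
      F1 x * fderiv ℝ u x (EuclideanSpace.single 1 1)) = ∫ x, u x := by
    rw [integral_add (i1 _ _ h0.continuous) (i1 _ _ h1.continuous), ibp _ _ h0, ibp _ _ h1,
      ← neg_add, ← integral_add (i2 _ (by fun_prop)) (i2 _ (by fun_prop)), ← integral_neg]
    congr 1; ext x
    rw [← add_mul, hdiv]; ring
  have iN : Integrable (fun x => ‖fderiv ℝ u x‖ ^ 2 / 2) := by
    refine (by fun_prop : Continuous (fun x => ‖fderiv ℝ u x‖ ^ 2 / 2)).integrable_of_hasCompactSupport
      (hcd.mono' (fun x hx => subset_tsupport _ ?_))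
    intro h; apply hx; simp [h]
  have iS : Integrable (fun x => F0 x * fderiv ℝ u x (EuclideanSpace.single 0 1) +
      F1 x * fderiv ℝ u x (EuclideanSpace.single 1 1)) :=
    (i1 _ _ h0.continuous).add (i1 _ _ h1.continuous)
  rw [integral_sub iN hIu, ← key, ← integral_sub iN iS, ← integral_const_mul,
    ← integral_indicator hΩ.measurableSet]
  refine integral_mono (IntegrableOn.integrable_indicator (Integrable.const_mul hintg _) hΩ.measurableSet)
    (iN.sub iS) ?_
  intro x
  by_cases hx : x ∈ Ω
  · simp only [indicator_of_mem hx, tr_norm_sq]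
    nlinarith [sq_nonneg (F0 x - fderiv ℝ u x (EuclideanSpace.single 0 1)),
      sq_nonneg (F1 x - fderiv ℝ u x (EuclideanSpace.single 1 1))]
  · have : fderiv ℝ u x = 0 := by
      by_contra h
      exact hx (hs (support_fderiv_subset ℝ h))
    simp [indicator_of_notMem hx, this]

lemma tr_maxsq (t : ℝ) : HasDerivAt (fun t : ℝ => max t 0 ^ 2) (2 * max t 0) t := by
  have hne : ∀ y : ℝ, y ≠ 0 → HasDerivAt (fun t : ℝ => max t 0 ^ 2) (2 * max y 0) y := by
    intro y hy
    rcases lt_or_gt_of_ne hy with h | h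
    · rw [max_eq_right h.le, mul_zero]
      refine (hasDerivAt_const y (0:ℝ)).congr_of_eventuallyEq ?_
      filter_upwards [gt_mem_nhds h] with z hz
      simp [max_eq_right (le_of_lt hz)]
    · rw [max_eq_left h.le]
      have := hasDerivAt_pow 2 y
      simp only [Nat.cast_ofNat, Nat.add_one_sub_one, pow_one] at this
      refine this.congr_of_eventuallyEq ?_
      filter_upwards [lt_mem_nhds h] with z hz
      simp [max_eq_left (le_of_lt hz)]
  by_cases h : t = 0
  · subst h
    exact hasDerivAt_of_hasDerivAt_of_ne' (g := fun t => 2 * max t 0) hne (by fun_prop) (by fun_prop) 0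
  · exact hne t h

lemma tr_phi (ε : ℝ) (hε : 0 < ε) : ∃ φ φ' : ℝ → ℝ, ContDiff ℝ 1 φ ∧ (∀ s, HasDerivAt φ (φ' s) s) ∧
    (∀ s, |φ' s| ≤ 1) ∧ (∀ s, |φ s - s| ≤ 2 * ε) ∧ ∀ s, |s| ≤ ε → φ s = 0 := by
  let D : ℝ → ℝ := fun s => max (s - ε) 0 / √(max (s - ε) 0 ^ 2 + ε ^ 2) +
      max (-s - ε) 0 / √(max (-s - ε) 0 ^ 2 + ε ^ 2)
  have hpos : ∀ p : ℝ, 0 < √(p ^ 2 + ε ^ 2) := fun p => by positivity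
  have hd : ∀ s, HasDerivAt (fun s => √(max (s - ε) 0 ^ 2 + ε ^ 2) - √(max (-s - ε) 0 ^ 2 + ε ^ 2))
      (D s) s := by
    intro s
    have e1 : HasDerivAt (fun s => max (s - ε) 0 ^ 2 + ε ^ 2) (2 * max (s - ε) 0) s := by
      have := ((tr_maxsq (s - ε)).comp s ((hasDerivAt_id s).sub_const ε)).add_const (ε ^ 2)
      simpa [Function.comp_def] using this
    have e2 : HasDerivAt (fun s => max (-s - ε) 0 ^ 2 + ε ^ 2) (-(2 * max (-s - ε) 0)) s := by
      have := ((tr_maxsq (-s - ε)).comp s ((hasDerivAt_id s).neg.sub_const ε)).add_const (ε ^ 2)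
      simpa [Function.comp_def] using this
    have := (e1.sqrt (by positivity)).sub (e2.sqrt (by positivity))
    refine this.congr_deriv ?_
    have := (hpos (max (s - ε) 0)).ne'
    have := (hpos (max (-s - ε) 0)).ne'
    simp only [D]
    field_simp
    ring
  have hq : ∀ p : ℝ, 0 ≤ p → 0 ≤ p / √(p ^ 2 + ε ^ 2) ∧ p / √(p ^ 2 + ε ^ 2) ≤ 1 := by
    intro p hp
    refine ⟨by positivity, (div_le_one (hpos p)).2 (Real.le_sqrt_of_sq_le (by nlinarith))⟩
  have hε0 : √(ε ^ 2) = ε := Real.sqrt_sq hε.le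
  have hb : ∀ p : ℝ, 0 ≤ p → p ≤ √(p ^ 2 + ε ^ 2) ∧ √(p ^ 2 + ε ^ 2) ≤ p + ε := by
    intro p hp
    exact ⟨Real.le_sqrt_of_sq_le (by nlinarith), Real.sqrt_le_iff.2 ⟨by positivity, by nlinarith⟩⟩
  refine ⟨_, D, ?_, hd, ?_, ?_, ?_⟩
  · rw [contDiff_one_iff_deriv]
    refine ⟨fun s => (hd s).differentiableAt, ?_⟩
    rw [show deriv _ = D from funext fun s => (hd s).deriv]
    refine Continuous.add (Continuous.div (by fun_prop) (by fun_prop) fun s => (hpos _).ne')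
      (Continuous.div (by fun_prop) (by fun_prop) fun s => (hpos _).ne')
  · intro s
    rcases le_total s 0 with h | h
    · simp only [D]
      rw [max_eq_right (show s - ε ≤ 0 by linarith), zero_div, zero_add, abs_le]
      have := hq (max (-s - ε) 0) (le_max_right _ _)
      constructor <;> linarith
    · simp only [D]
      rw [max_eq_right (show -s - ε ≤ 0 by linarith), zero_div, add_zero, abs_le]
      have := hq (max (s - ε) 0) (le_max_right _ _)
      constructor <;> linarith
  · intro s
    have b1 := hb (max (s - ε) 0) (le_max_right _ _)
    have b2 := hb (max (-s - ε) 0) (le_max_right _ _)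
    rw [abs_le]
    rcases le_total s ε with h | h
    · rw [max_eq_right (show s - ε ≤ 0 by linarith)] at b1 ⊢
      rcases le_total (-s) ε with h' | h'
      · rw [max_eq_right (show -s - ε ≤ 0 by linarith)] at b2 ⊢
        constructor <;> linarith
      · rw [max_eq_left (show 0 ≤ -s - ε by linarith)] at b2 ⊢
        simp only [ne_eq, OfNat.ofNat_ne_zero, not_false_eq_true, zero_pow, zero_add, hε0]
        constructor <;> linarith
    · rw [max_eq_left (show 0 ≤ s - ε by linarith)] at b1 ⊢
      rw [max_eq_right (show -s - ε ≤ 0 by linarith)]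
      simp only [ne_eq, OfNat.ofNat_ne_zero, not_false_eq_true, zero_pow, zero_add, hε0]
      constructor <;> linarith
  · intro s hs
    rw [abs_le] at hs
    rw [max_eq_right (show s - ε ≤ 0 by linarith), max_eq_right (show -s - ε ≤ 0 by linarith), sub_self]

lemma tr_lower (Ω : Set E2) (hΩ : IsOpen Ω) (hbd : Bornology.IsBounded Ω) (w : E2 → ℝ)
    (hw : ContDiff ℝ 1 w) (hz : ∀ x ∈ closure Ω, x ∉ Ω → w x = 0) (ε : ℝ) (hε : 0 < ε) :
    ∃ u : E2 → ℝ, ContDiff ℝ 1 u ∧ HasCompactSupport u ∧ tsupport u ⊆ Ω ∧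
      ∫ x, (‖fderiv ℝ u x‖ ^ 2 / 2 - u x) ≤
        (∫ x in Ω, (‖fderiv ℝ w x‖ ^ 2 / 2 - w x)) + 2 * ε * volume.real Ω := by
  obtain ⟨φ, φ', hφ, hφ', hb, hcl, h0⟩ := tr_phi ε hε
  have hK : IsCompact (closure Ω ∩ {x | ε ≤ |w x|}) :=
    hbd.isCompact_closure.inter_right (isClosed_le continuous_const hw.continuous.abs)
  have hKΩ : closure Ω ∩ {x | ε ≤ |w x|} ⊆ Ω := by
    rintro x ⟨hx, hx'⟩
    by_contra h
    have := hz x hx h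
    simp [this] at hx'; linarith
  have hsup : Function.support (Ω.indicator (φ ∘ w)) ⊆ closure Ω ∩ {x | ε ≤ |w x|} := by
    intro x hx
    have hxΩ : x ∈ Ω := by by_contra h; exact hx (indicator_of_notMem h _)
    refine ⟨subset_closure hxΩ, ?_⟩
    by_contra h
    simp only [mem_ofPred_eq, not_le] at h
    apply hx
    rw [indicator_of_mem hxΩ]; exact h0 _ h.le
  have hts : tsupport (Ω.indicator (φ ∘ w)) ⊆ closure Ω ∩ {x | ε ≤ |w x|} :=
    closure_minimal hsup hK.isClosed
  have hcs : HasCompactSupport (Ω.indicator (φ ∘ w)) := hK.of_isClosed_subset (isClosed_tsupport _) hts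
  have hev : ∀ x ∈ Ω, Ω.indicator (φ ∘ w) =ᶠ[nhds x] φ ∘ w := by
    intro x hx
    filter_upwards [hΩ.mem_nhds hx] with y hy
    exact indicator_of_mem hy _
  have hCD : ContDiff ℝ 1 (Ω.indicator (φ ∘ w)) := by
    rw [contDiff_iff_contDiffAt]
    intro x
    by_cases hx : x ∈ Ω
    · exact (hφ.comp hw).contDiffAt.congr_of_eventuallyEq (hev x hx)
    · have : Ω.indicator (φ ∘ w) =ᶠ[nhds x] fun _ => 0 :=
        notMem_tsupport_iff_eventuallyEq.1 fun h => hx (hKΩ (hts h))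
      exact contDiffAt_const.congr_of_eventuallyEq this
  refine ⟨Ω.indicator (φ ∘ w), hCD, hcs, hts.trans hKΩ, ?_⟩
  have hcf : Continuous (fderiv ℝ (Ω.indicator (φ ∘ w))) := hCD.continuous_fderiv one_ne_zero
  have hcw : Continuous (fderiv ℝ w) := hw.continuous_fderiv one_ne_zero
  have hcu := hCD.continuous
  have hcw' := hw.continuous
  rw [← setIntegral_eq_integral_of_forall_compl_eq_zero (s := Ω)]
  · have hvol : volume Ω ≠ ⊤ := hbd.measure_lt_top.ne
    have hi : ∀ g : E2 → ℝ, Continuous g → IntegrableOn g Ω := fun g hg =>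
      (hg.continuousOn.integrableOn_compact hbd.isCompact_closure).mono_set subset_closure
    have e : 2 * ε * volume.real Ω = ∫ x in Ω, 2 * ε := by
      rw [setIntegral_const, smul_eq_mul]; ring
    rw [e, ← integral_add (hi _ (by fun_prop)) (hi _ (by fun_prop))]
    refine setIntegral_mono_on (hi _ (by fun_prop)) (hi _ (by fun_prop)) hΩ.measurableSet ?_
    intro x hx
    have hf : fderiv ℝ (Ω.indicator (φ ∘ w)) x = φ' (w x) • fderiv ℝ w x := by
      rw [(hev x hx).fderiv_eq]
      exact ((hφ' (w x)).comp_hasFDerivAt x (hw.differentiable one_ne_zero x).hasFDerivAt).fderiv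
    rw [hf, norm_smul, indicator_of_mem hx, Real.norm_eq_abs]
    have h1 : |φ' (w x)| * ‖fderiv ℝ w x‖ ≤ ‖fderiv ℝ w x‖ :=
      mul_le_of_le_one_left (norm_nonneg _) (hb _)
    have h2 := abs_le.1 (hcl (w x))
    have h3 : (|φ' (w x)| * ‖fderiv ℝ w x‖) ^ 2 ≤ ‖fderiv ℝ w x‖ ^ 2 :=
      pow_le_pow_left₀ (by positivity) h1 2
    simp only [Function.comp_apply]
    linarith [h2.1]
  · intro x hx
    have hx' : x ∉ tsupport (Ω.indicator (φ ∘ w)) := fun h => hx (hKΩ (hts h))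
    have h1 : fderiv ℝ (Ω.indicator (φ ∘ w)) x = 0 := by
      by_contra h
      exact hx' (support_fderiv_subset ℝ h)
    rw [h1, indicator_of_notMem hx]; simp

noncomputable def cck (a : ℝ) (k : ℕ) : ℝ := 4 * (-1) ^ k / (a * kap a k ^ 3)

noncomputable def chb (a b : ℝ) (k : ℕ) : ℝ := Real.cosh (kap a k * b / 2)

lemma tr_int3 (c b α β γ : ℝ) (hc : c ≠ 0) :
    ∫ s in (-(b/2))..(b/2), (α * Real.cosh (2 * c * s) + β * Real.cosh (c * s) + γ) =
      α * (2 * Real.sinh (c * b / 2) * Real.cosh (c * b / 2) / c) +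
      β * (2 * Real.sinh (c * b / 2) / c) + γ * b := by
  rw [intervalIntegral.integral_add (Continuous.intervalIntegrable (by fun_prop) _ _)
    (Continuous.intervalIntegrable (by fun_prop) _ _),
    intervalIntegral.integral_add (Continuous.intervalIntegrable (by fun_prop) _ _)
    (Continuous.intervalIntegrable (by fun_prop) _ _), intervalIntegral.integral_const_mul,
    intervalIntegral.integral_const_mul, tr_cosh_int _ _ hc, tr_cosh_int _ _ (by positivity),
    intervalIntegral.integral_const]
  have : 2 * c * b / 2 = 2 * (c * b / 2) := by ring
  rw [this, Real.sinh_two_mul]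
  simp only [smul_eq_mul]
  field_simp
  ring

lemma tr_sgn (k : ℕ) : ((-1 : ℝ) ^ k) * (-1) ^ k = 1 := by
  rw [← mul_pow]; simp

lemma tr_outer_up (a b : ℝ) (ha : 0 < a) (N : ℕ) :
    ∫ s in (-(b/2))..(b/2), (a ^ 3 / 12 + ∑ k ∈ Finset.range N,
      (a / 2 * ((-(cck a k * kap a k * Real.sinh (kap a k * s) / chb a b k)) ^ 2 +
          (cck a k * kap a k * Real.cosh (kap a k * s) / chb a b k) ^ 2)
        - 2 * (cck a k * kap a k * Real.cosh (kap a k * s) / chb a b k) *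
          (2 * (-1) ^ k / kap a k ^ 2)))
    = a ^ 3 * b / 12 - ∑ k ∈ Finset.range N,
      16 / (a * kap a k ^ 5) * Real.tanh (kap a k * b / 2) := by
  rw [intervalIntegral.integral_add (Continuous.intervalIntegrable (by fun_prop) _ _)
    (Continuous.intervalIntegrable (by fun_prop) _ _), intervalIntegral.integral_const,
    intervalIntegral.integral_finsetSum
      (fun k _ => Continuous.intervalIntegrable (by fun_prop) _ _), sub_eq_add_neg (a ^ 3 * b / 12),
    ← Finset.sum_neg_distrib]
  congr 1
  · simp only [smul_eq_mul]; ring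
  refine Finset.sum_congr rfl fun k _ => ?_
  have hc := (kap_pos a ha k).ne'
  have hC : Real.cosh (kap a k * b / 2) ≠ 0 := (Real.cosh_pos _).ne'
  have : (fun s => (a / 2 * ((-(cck a k * kap a k * Real.sinh (kap a k * s) / chb a b k)) ^ 2 +
          (cck a k * kap a k * Real.cosh (kap a k * s) / chb a b k) ^ 2)
        - 2 * (cck a k * kap a k * Real.cosh (kap a k * s) / chb a b k) *
          (2 * (-1) ^ k / kap a k ^ 2))) = fun s =>
      (a / 2 * (cck a k * kap a k / chb a b k) ^ 2) * Real.cosh (2 * kap a k * s) +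
      (- 2 * (cck a k * kap a k / chb a b k) * (2 * (-1) ^ k / kap a k ^ 2)) *
        Real.cosh (kap a k * s) + 0 := by
    ext s
    rw [show 2 * kap a k * s = 2 * (kap a k * s) by ring, Real.cosh_two_mul]
    ring
  rw [this, tr_int3 _ _ _ _ _ hc, Real.tanh_eq_sinh_div_cosh]
  unfold chb cck
  have hs := tr_sgn k
  generalize (-1 : ℝ) ^ k = σ at *
  generalize Real.cosh (kap a k * b / 2) = C at *
  generalize Real.sinh (kap a k * b / 2) = S at *
  generalize kap a k = c at *
  have hs2 : σ ^ 2 = 1 := by rw [sq]; exact hs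
  field_simp
  rw [hs2]; ring

lemma tr_outer_low (a b : ℝ) (ha : 0 < a) (N : ℕ) :
    ∫ s in (-(b/2))..(b/2), (∑ k ∈ Finset.range N,
      (a / 4 * ((-(cck a k * kap a k * Real.sinh (kap a k * s) / chb a b k)) ^ 2 +
          (-(cck a k * (1 - Real.cosh (kap a k * s) / chb a b k) * kap a k)) ^ 2)
        - (cck a k * (1 - Real.cosh (kap a k * s) / chb a b k)) * (2 * (-1) ^ k / kap a k)))
    = -(1/2) * ∑ k ∈ Finset.range N,
      (8 * b / (a * kap a k ^ 4) - 16 / (a * kap a k ^ 5) * Real.tanh (kap a k * b / 2)) := by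
  rw [intervalIntegral.integral_finsetSum
      (fun k _ => Continuous.intervalIntegrable (by fun_prop) _ _), Finset.mul_sum]
  refine Finset.sum_congr rfl fun k _ => ?_
  have hc := (kap_pos a ha k).ne'
  have hC : Real.cosh (kap a k * b / 2) ≠ 0 := (Real.cosh_pos _).ne'
  have : (fun s => (a / 4 * ((-(cck a k * kap a k * Real.sinh (kap a k * s) / chb a b k)) ^ 2 +
          (-(cck a k * (1 - Real.cosh (kap a k * s) / chb a b k) * kap a k)) ^ 2)
        - (cck a k * (1 - Real.cosh (kap a k * s) / chb a b k)) * (2 * (-1) ^ k / kap a k))) =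
      fun s =>
      (a / 4 * (cck a k * kap a k / chb a b k) ^ 2) * Real.cosh (2 * kap a k * s) +
      (- a / 2 * cck a k ^ 2 * kap a k ^ 2 / chb a b k + cck a k / chb a b k * (2 * (-1) ^ k / kap a k)) *
        Real.cosh (kap a k * s) + (a / 4 * cck a k ^ 2 * kap a k ^ 2
          - cck a k * (2 * (-1) ^ k / kap a k)) := by
    ext s
    rw [show 2 * kap a k * s = 2 * (kap a k * s) by ring, Real.cosh_two_mul]
    ring
  rw [this, tr_int3 _ _ _ _ _ hc, Real.tanh_eq_sinh_div_cosh]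
  unfold chb cck
  have hs := tr_sgn k
  generalize (-1 : ℝ) ^ k = σ at *
  generalize Real.cosh (kap a k * b / 2) = C at *
  generalize Real.sinh (kap a k * b / 2) = S at *
  generalize kap a k = c at *
  have hs2 : σ ^ 2 = 1 := by rw [sq]; exact hs
  field_simp
  rw [hs2]; ring

lemma tr_sep (x : E2) (p q : ℝ → ℝ) (p' q' : ℝ) (hp : HasDerivAt p p' (x 0))
    (hq : HasDerivAt q q' (x 1)) :
    HasFDerivAt (fun z : E2 => p (z 0) * q (z 1))
      ((p' * q (x 1)) • (EuclideanSpace.proj 0 : E2 →L[ℝ] ℝ) +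
        (p (x 0) * q') • (EuclideanSpace.proj 1 : E2 →L[ℝ] ℝ)) x := by
  have h0 : HasFDerivAt (fun z : E2 => z 0) (EuclideanSpace.proj 0 : E2 →L[ℝ] ℝ) x :=
    (EuclideanSpace.proj 0 : E2 →L[ℝ] ℝ).hasFDerivAt
  have h1 : HasFDerivAt (fun z : E2 => z 1) (EuclideanSpace.proj 1 : E2 →L[ℝ] ℝ) x :=
    (EuclideanSpace.proj 1 : E2 →L[ℝ] ℝ).hasFDerivAt
  have := (hp.comp_hasFDerivAt x h0).mul (hq.comp_hasFDerivAt x h1)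
  refine this.congr_fderiv ?_
  ext i
  simp
  ring

lemma tr_sep_sum (x : E2) (N : ℕ) (p q : ℕ → ℝ → ℝ) (p' q' : ℕ → ℝ → ℝ)
    (hp : ∀ k s, HasDerivAt (p k) (p' k s) s) (hq : ∀ k s, HasDerivAt (q k) (q' k s) s) :
    fderiv ℝ (fun z : E2 => ∑ k ∈ Finset.range N, p k (z 0) * q k (z 1)) x (EuclideanSpace.single 0 1)
      = ∑ k ∈ Finset.range N, p' k (x 0) * q k (x 1) ∧
    fderiv ℝ (fun z : E2 => ∑ k ∈ Finset.range N, p k (z 0) * q k (z 1)) x (EuclideanSpace.single 1 1)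
      = ∑ k ∈ Finset.range N, p k (x 0) * q' k (x 1) := by
  have := HasFDerivAt.fun_sum (u := Finset.range N)
    (fun k _ => tr_sep x (p k) (q k) _ _ (hp k (x 0)) (hq k (x 1)))
  rw [this.fderiv]
  simp

def rect (a b : ℝ) : Set E2 :=
  {x : E2 | x 0 ∈ Ioo (-(b / 2)) (b / 2) ∧ x 1 ∈ Ioo (-(a / 2)) (a / 2)}

lemma rect_open (a b : ℝ) : IsOpen (rect a b) := by
  have h0 : Continuous (fun z : E2 => z 0) := by fun_prop
  have h1 : Continuous (fun z : E2 => z 1) := by fun_prop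
  exact (isOpen_Ioo.preimage h0).inter (isOpen_Ioo.preimage h1)

lemma rect_closure (a b : ℝ) (x : E2) (hx : x ∈ closure (rect a b)) :
    x 0 ∈ Icc (-(b / 2)) (b / 2) ∧ x 1 ∈ Icc (-(a / 2)) (a / 2) := by
  have h0 : Continuous (fun z : E2 => z 0) := by fun_prop
  have h1 : Continuous (fun z : E2 => z 1) := by fun_prop
  have hcl : IsClosed {x : E2 | x 0 ∈ Icc (-(b / 2)) (b / 2) ∧ x 1 ∈ Icc (-(a / 2)) (a / 2)} :=
    (isClosed_Icc.preimage h0).inter (isClosed_Icc.preimage h1)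
  have hsub : rect a b ⊆ {x : E2 | x 0 ∈ Icc (-(b / 2)) (b / 2) ∧ x 1 ∈ Icc (-(a / 2)) (a / 2)} := by
    intro y hy
    exact And.intro (Ioo_subset_Icc_self hy.1) (Ioo_subset_Icc_self hy.2)
  exact closure_minimal hsub hcl hx

lemma rect_bdd (a b : ℝ) : Bornology.IsBounded (rect a b) := by
  rw [isBounded_iff_forall_norm_le]
  refine ⟨|b| + |a|, fun x hx => ?_⟩
  have h0 : |x 0| ≤ |b| := by
    rw [abs_le]; have := hx.1; have := le_abs_self b
    constructor <;> linarith [this, hx.1.1, hx.1.2, abs_nonneg b]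
  have h1 : |x 1| ≤ |a| := by
    rw [abs_le]; have := le_abs_self a
    constructor <;> linarith [this, hx.2.1, hx.2.2, abs_nonneg a]
  have : ‖x‖ ^ 2 = |x 0| ^ 2 + |x 1| ^ 2 := by
    rw [EuclideanSpace.norm_sq_eq]; simp [Fin.sum_univ_two]
  refine abs_le_of_sq_le_sq' ?_ (by positivity) |>.2
  rw [this]
  nlinarith [abs_nonneg (x 0), abs_nonneg (x 1), abs_nonneg a, abs_nonneg b]

lemma tr_up_val (a b : ℝ) (ha : 0 < a) (hb : 0 < b) (N : ℕ) (u : E2 → ℝ) (hu : ContDiff ℝ 1 u)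
    (hc : HasCompactSupport u) (hs : tsupport u ⊆ rect a b) :
    -(1/2) * (a ^ 3 * b / 12 - ∑ k ∈ Finset.range N,
      16 / (a * kap a k ^ 5) * Real.tanh (kap a k * b / 2)) ≤
      ∫ x, (‖fderiv ℝ u x‖ ^ 2 / 2 - u x) := by
  let A : ℕ → ℝ → ℝ := fun k s => -(cck a k * kap a k * Real.sinh (kap a k * s) / chb a b k)
  let B : ℕ → ℝ → ℝ := fun k s => cck a k * kap a k * Real.cosh (kap a k * s) / chb a b k
  let F0 : E2 → ℝ := fun x => ∑ k ∈ Finset.range N, A k (x 0) * Real.cos (kap a k * x 1)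
  let F1 : E2 → ℝ := fun x => - x 1 + ∑ k ∈ Finset.range N, B k (x 0) * Real.sin (kap a k * x 1)
  have h0 : ContDiff ℝ 1 F0 := by
    simp only [F0, A]
    fun_prop
  have h1' : ContDiff ℝ 1 (fun x : E2 => ∑ k ∈ Finset.range N, B k (x 0) * Real.sin (kap a k * x 1)) := by
    simp only [B]
    fun_prop
  have h1 : ContDiff ℝ 1 F1 := by
    simp only [F1, B]
    fun_prop
  have hA : ∀ k s, HasDerivAt (A k)
      (-(cck a k * kap a k * (Real.cosh (kap a k * s) * kap a k) / chb a b k)) s := by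
    intro k s
    have := (((((hasDerivAt_id s).const_mul (kap a k)).sinh).const_mul (cck a k * kap a k)).div_const
      (chb a b k)).neg
    refine this.congr_deriv ?_
    simp
  have hB : ∀ k s, HasDerivAt (B k)
      (cck a k * kap a k * (Real.sinh (kap a k * s) * kap a k) / chb a b k) s := by
    intro k s
    have := (((((hasDerivAt_id s).const_mul (kap a k)).cosh).const_mul (cck a k * kap a k)).div_const
      (chb a b k))
    refine this.congr_deriv ?_
    simp
  have hcos : ∀ k s, HasDerivAt (fun t => Real.cos (kap a k * t)) (-Real.sin (kap a k * s) * kap a k) s := by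
    intro k s
    refine (((hasDerivAt_id s).const_mul (kap a k)).cos).congr_deriv ?_
    simp
  have hsin : ∀ k s, HasDerivAt (fun t => Real.sin (kap a k * t)) (Real.cos (kap a k * s) * kap a k) s := by
    intro k s
    refine (((hasDerivAt_id s).const_mul (kap a k)).sin).congr_deriv ?_
    simp
  have hdiv : ∀ x, fderiv ℝ F0 x (EuclideanSpace.single 0 1) +
      fderiv ℝ F1 x (EuclideanSpace.single 1 1) = -1 := by
    intro x
    have e0 := (tr_sep_sum x N A _ _ _ hA hcos).1
    have e1 := (tr_sep_sum x N B _ _ _ hB hsin).2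
    have hp : HasFDerivAt (fun z : E2 => - z 1) (-(EuclideanSpace.proj 1 : E2 →L[ℝ] ℝ)) x :=
      (EuclideanSpace.proj 1 : E2 →L[ℝ] ℝ).hasFDerivAt.neg
    have e2 := (hp.add (h1'.differentiable one_ne_zero x).hasFDerivAt).fderiv
    have e3 : fderiv ℝ F1 x = _ := e2
    rw [e3, add_apply, e1]
    have e4 : fderiv ℝ F0 x (EuclideanSpace.single 0 1) = _ := e0
    rw [e4]
    have e5 : (-(EuclideanSpace.proj 1 : E2 →L[ℝ] ℝ)) (EuclideanSpace.single 1 1) = -1 := by simp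
    rw [e5]
    rw [add_left_comm, ← Finset.sum_add_distrib, Finset.sum_eq_zero]
    · simp
    · intro k _; simp only [B]; ring
  have hintg : IntegrableOn (fun x => F0 x ^ 2 + F1 x ^ 2) (rect a b) := by
    have := h0.continuous
    have := h1.continuous
    exact ((by fun_prop : Continuous (fun x => F0 x ^ 2 + F1 x ^ 2)).continuousOn.integrableOn_compact
      (rect_bdd a b).isCompact_closure).mono_set subset_closure
  have key := tr_upper (rect a b) (rect_open a b) F0 F1 h0 h1 hdiv hintg u hu hc hs
  have hval : ∫ x in rect a b, (F0 x ^ 2 + F1 x ^ 2) = a ^ 3 * b / 12 - ∑ k ∈ Finset.range N,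
      16 / (a * kap a k ^ 5) * Real.tanh (kap a k * b / 2) := by
    rw [← tr_outer_up a b ha N]
    refine (tr_fubini a b ha hb (fun s t => (∑ k ∈ Finset.range N, A k s * Real.cos (kap a k * t)) ^ 2
      + (- t + ∑ k ∈ Finset.range N, B k s * Real.sin (kap a k * t)) ^ 2)
      (by simp only [A, B]; fun_prop)).trans ?_
    congr 1; ext s
    exact tr_inner_up a ha N (fun k => A k s) (fun k => B k s)
  rwa [hval] at key

lemma tr_low_val (a b : ℝ) (ha : 0 < a) (hb : 0 < b) (N : ℕ) (ε : ℝ) (hε : 0 < ε) :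
    ∃ u : E2 → ℝ, ContDiff ℝ 1 u ∧ HasCompactSupport u ∧ tsupport u ⊆ rect a b ∧
      ∫ x, (‖fderiv ℝ u x‖ ^ 2 / 2 - u x) ≤
      -(1/2) * ∑ k ∈ Finset.range N,
      (8 * b / (a * kap a k ^ 4) - 16 / (a * kap a k ^ 5) * Real.tanh (kap a k * b / 2))
        + 2 * ε * volume.real (rect a b) := by
  let p : ℕ → ℝ → ℝ := fun k s => cck a k * (1 - Real.cosh (kap a k * s) / chb a b k)
  let w : E2 → ℝ := fun x => ∑ k ∈ Finset.range N, p k (x 0) * Real.cos (kap a k * x 1)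
  have hw : ContDiff ℝ 1 w := by
    simp only [w, p]
    fun_prop
  have hp : ∀ k s, HasDerivAt (p k)
      (-(cck a k * kap a k * Real.sinh (kap a k * s) / chb a b k)) s := by
    intro k s
    have := ((((((hasDerivAt_id s).const_mul (kap a k)).cosh)).div_const
      (chb a b k)).const_sub 1).const_mul (cck a k)
    refine this.congr_deriv ?_
    simp; ring
  have hcos : ∀ k s, HasDerivAt (fun t => Real.cos (kap a k * t)) (-Real.sin (kap a k * s) * kap a k) s := by
    intro k s
    refine (((hasDerivAt_id s).const_mul (kap a k)).cos).congr_deriv ?_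
    simp
  have hz : ∀ x ∈ closure (rect a b), x ∉ rect a b → w x = 0 := by
    intro x hx hxn
    have hcl := rect_closure a b x hx
    refine Finset.sum_eq_zero fun k _ => ?_
    by_cases h0 : x 0 ∈ Ioo (-(b / 2)) (b / 2)
    · have h1 : x 1 ∉ Ioo (-(a / 2)) (a / 2) := fun h => hxn ⟨h0, h⟩
      have hcz : Real.cos (kap a k * x 1) = 0 := by
        by_cases h2 : x 1 = a / 2
        · rw [h2, ← mul_div_assoc, tr_cos_half a ha]
        · have h3 : x 1 = -(a / 2) := by
            by_contra h3
            exact h1 ⟨lt_of_le_of_ne hcl.2.1 (Ne.symm h3), lt_of_le_of_ne hcl.2.2 h2⟩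
          rw [h3, mul_neg, Real.cos_neg, ← mul_div_assoc, tr_cos_half a ha]
      rw [hcz, mul_zero]
    · have hC : Real.cosh (kap a k * b / 2) ≠ 0 := (Real.cosh_pos _).ne'
      have hcz : p k (x 0) = 0 := by
        simp only [p, chb]
        by_cases h2 : x 0 = b / 2
        · rw [h2, ← mul_div_assoc, div_self hC]; simp
        · have h3 : x 0 = -(b / 2) := by
            by_contra h3
            exact h0 ⟨lt_of_le_of_ne hcl.1.1 (Ne.symm h3), lt_of_le_of_ne hcl.1.2 h2⟩
          rw [h3, mul_neg, Real.cosh_neg, ← mul_div_assoc, div_self hC]; simp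
      rw [hcz, zero_mul]
  obtain ⟨u, h1, h2, h3, h4⟩ := tr_lower (rect a b) (rect_open a b) (rect_bdd a b) w hw hz ε hε
  refine ⟨u, h1, h2, h3, h4.trans_eq ?_⟩
  congr 1
  rw [← tr_outer_low a b ha N]
  have : (fun x => ‖fderiv ℝ w x‖ ^ 2 / 2 - w x) = fun x : E2 =>
    (((∑ k ∈ Finset.range N, (-(cck a k * kap a k * Real.sinh (kap a k * x 0) / chb a b k)) *
        Real.cos (kap a k * x 1)) ^ 2
      + (∑ k ∈ Finset.range N, (-(p k (x 0) * kap a k)) * Real.sin (kap a k * x 1)) ^ 2) / 2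
      - ∑ k ∈ Finset.range N, p k (x 0) * Real.cos (kap a k * x 1)) := by
    ext x
    have e := tr_sep_sum x N p _ _ _ hp hcos
    rw [tr_norm_sq]
    have e0 : fderiv ℝ w x (EuclideanSpace.single 0 1) = _ := e.1
    have e1 : fderiv ℝ w x (EuclideanSpace.single 1 1) = _ := e.2
    rw [e0, e1]
    congr 4
    refine Finset.sum_congr rfl fun k _ => by ring
  rw [this]
  refine (tr_fubini a b ha hb (fun s t =>
    (((∑ k ∈ Finset.range N, (-(cck a k * kap a k * Real.sinh (kap a k * s) / chb a b k)) *
        Real.cos (kap a k * t)) ^ 2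
      + (∑ k ∈ Finset.range N, (-(p k s * kap a k)) * Real.sin (kap a k * t)) ^ 2) / 2
      - ∑ k ∈ Finset.range N, p k s * Real.cos (kap a k * t)))
      (by simp only [p]; fun_prop)).trans ?_
  congr 1; ext s
  exact tr_inner_low a ha N _ _ _

lemma tr_odd (s : ℕ) (z : ℝ) (hz : HasSum (fun n : ℕ => 1 / (n : ℝ) ^ s) z) :
    HasSum (fun k : ℕ => 1 / (2 * (k : ℝ) + 1) ^ s) (z - z / 2 ^ s) := by
  generalize hf : (fun n : ℕ => 1 / (n : ℝ) ^ s) = f at hz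
  have hfn : ∀ n, f n = 1 / (n : ℝ) ^ s := fun n => by rw [← hf]
  have e1 : (fun k : ℕ => f (2 * k)) = fun k => f k / 2 ^ s := by
    funext k
    rw [hfn, hfn, Nat.cast_mul, mul_pow, div_div, mul_comm, Nat.cast_ofNat]
  have he : HasSum (fun k : ℕ => f (2 * k)) (z / 2 ^ s) := by
    rw [e1]; exact hz.div_const _
  have hos : Summable (fun k : ℕ => f (2 * k + 1)) :=
    hz.summable.comp_injective (i := fun k => 2 * k + 1) (fun x y h => by simpa using h)
  have h := (he.even_add_odd hos.hasSum).unique hz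
  have h2 := hos.hasSum
  have h3 : ∑' k : ℕ, f (2 * k + 1) = z - z / 2 ^ s := by linarith
  have e2 : (fun k : ℕ => f (2 * k + 1)) = fun k : ℕ => 1 / (2 * (k : ℝ) + 1) ^ s := by
    funext k
    rw [hfn]; push_cast; rfl
  rw [h3, e2] at h2
  exact h2

lemma tr_odd4 : HasSum (fun k : ℕ => 1 / (2 * (k : ℝ) + 1) ^ 4) (π ^ 4 / 96) := by
  have := tr_odd 4 _ hasSum_zeta_four
  convert this using 1
  ring

lemma tr_odd5 : HasSum (fun k : ℕ => 1 / (2 * (k : ℝ) + 1) ^ 5)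
    (31 / 32 * ∑' k : ℕ, ((k : ℝ) + 1)⁻¹ ^ 5) := by
  have hs : Summable (fun n : ℕ => 1 / (n : ℝ) ^ 5) := Real.summable_one_div_nat_pow.2 (by norm_num)
  have h1 := hs.tsum_eq_zero_add
  have h2 : ∑' k : ℕ, ((k : ℝ) + 1)⁻¹ ^ 5 = ∑' n : ℕ, 1 / (n : ℝ) ^ 5 := by
    rw [h1]; simp
  have := tr_odd 5 _ hs.hasSum
  rw [h2]
  convert this using 1
  ring

lemma tr_tanh (x : ℝ) (hx : 0 < x) : 1 - Real.tanh x ≤ 1 / x := by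
  rw [Real.tanh_eq_sinh_div_cosh]
  have hC := Real.cosh_pos x
  have : 1 - Real.sinh x / Real.cosh x = Real.exp (-x) / Real.cosh x := by
    rw [← Real.cosh_sub_sinh]; field_simp
  rw [this, div_le_div_iff₀ hC hx, one_mul]
  have h1 : Real.exp (-x) * x ≤ 1 := by
    have := Real.add_one_le_exp x
    calc Real.exp (-x) * x ≤ Real.exp (-x) * Real.exp x := by gcongr; linarith
      _ = 1 := by rw [← Real.exp_add]; simp
  exact h1.trans (Real.one_le_cosh x)

/-- For `0 < a ≤ b`, the torsional rigidity of the rectangle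
`R_{a,b} = (-b/2,b/2) × (-a/2,a/2)` satisfies
`|T(R_{a,b}) - a³b/12 + 31ζ(5)a⁴/(2π⁵)| ≤ a⁵/(15b)`, where `ζ(5) = Σ_{k≥1} k⁻⁵`. -/
theorem torsion_rectangle_asymptotics (a b : ℝ) (ha : 0 < a) (hab : a ≤ b) :
    |torsionalRigidity {x : EuclideanSpace ℝ (Fin 2) |
        x 0 ∈ Ioo (-(b / 2)) (b / 2) ∧ x 1 ∈ Ioo (-(a / 2)) (a / 2)} -
      a ^ 3 * b / 12 + 31 * (∑' k : ℕ, ((k : ℝ) + 1)⁻¹ ^ 5) * a ^ 4 / (2 * π ^ 5)| ≤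
    a ^ 5 / (15 * b) := by
  have hb : 0 < b := lt_of_lt_of_le ha hab
  change |torsionalRigidity (rect a b) - _ + _| ≤ _
  set Z := ∑' k : ℕ, ((k : ℝ) + 1)⁻¹ ^ 5 with hZ
  have hpi := Real.pi_pos
  have hk4 : HasSum (fun k => 8 * b / (a * kap a k ^ 4)) (a ^ 3 * b / 12) := by
    have h := tr_odd4.mul_left (8 * b * a ^ 3 / π ^ 4)
    have e1 : (fun k => 8 * b / (a * kap a k ^ 4)) =
        fun k : ℕ => 8 * b * a ^ 3 / π ^ 4 * (1 / (2 * (k : ℝ) + 1) ^ 4) := by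
      funext k; unfold kap; field_simp
    have e2 : a ^ 3 * b / 12 = 8 * b * a ^ 3 / π ^ 4 * (π ^ 4 / 96) := by
      field_simp; norm_num
    rw [e1, e2]; exact h
  have hk5 : HasSum (fun k => 16 / (a * kap a k ^ 5)) (31 * Z * a ^ 4 / (2 * π ^ 5)) := by
    have h := tr_odd5.mul_left (16 * a ^ 4 / π ^ 5)
    rw [← hZ] at h
    have e1 : (fun k => 16 / (a * kap a k ^ 5)) =
        fun k : ℕ => 16 * a ^ 4 / π ^ 5 * (1 / (2 * (k : ℝ) + 1) ^ 5) := by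
      funext k; unfold kap; field_simp
    have e2 : 31 * Z * a ^ 4 / (2 * π ^ 5) = 16 * a ^ 4 / π ^ 5 * (31 / 32 * Z) := by
      field_simp; ring
    rw [e1, e2]; exact h
  set τ : ℕ → ℝ := fun k => 16 / (a * kap a k ^ 5) * Real.tanh (kap a k * b / 2) with hτ
  have hcoef : ∀ k, 0 ≤ 16 / (a * kap a k ^ 5) := fun k => by
    have := kap_pos a ha k; positivity
  have hxp : ∀ k, 0 < kap a k * b / 2 := fun k => by
    have := kap_pos a ha k; positivity
  have hth0 : ∀ k, 0 ≤ Real.tanh (kap a k * b / 2) := fun k => by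
    rw [Real.tanh_eq_sinh_div_cosh]
    exact div_nonneg (Real.sinh_nonneg_iff.2 (hxp k).le) (Real.cosh_pos _).le
  have hτs : Summable τ := Summable.of_nonneg_of_le (fun k => mul_nonneg (hcoef k) (hth0 k))
    (fun k => mul_le_of_le_one_right (hcoef k) (Real.tanh_lt_one _).le) hk5.summable
  -- the variational characterisation
  set S : Set ℝ := {r : ℝ | ∃ u : E2 → ℝ, ContDiff ℝ 1 u ∧ HasCompactSupport u ∧
    tsupport u ⊆ rect a b ∧ r = ∫ x, (‖fderiv ℝ u x‖ ^ 2 / 2 - u x)} with hS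
  have hT : torsionalRigidity (rect a b) = -2 * sInf S := rfl
  have hne : S.Nonempty := ⟨_, fun _ => 0, contDiff_const, HasCompactSupport.zero, by
    simp [tsupport], rfl⟩
  have hlb : ∀ N, ∀ r ∈ S, -(1/2) * (a ^ 3 * b / 12 - ∑ k ∈ Finset.range N, τ k) ≤ r := by
    rintro N r ⟨u, h1, h2, h3, rfl⟩
    exact tr_up_val a b ha hb N u h1 h2 h3
  have hup : ∀ N, torsionalRigidity (rect a b) ≤ a ^ 3 * b / 12 - ∑ k ∈ Finset.range N, τ k := by
    intro N
    have := le_csInf hne (hlb N)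
    rw [hT]; linarith
  have hlow : ∀ N, ∑ k ∈ Finset.range N, (8 * b / (a * kap a k ^ 4) - τ k) ≤
      torsionalRigidity (rect a b) := by
    intro N
    have hv : 0 ≤ volume.real (rect a b) := measureReal_nonneg
    refine le_of_forall_pos_le_add fun δ hδ => ?_
    obtain ⟨u, h1, h2, h3, h4⟩ := tr_low_val a b ha hb N (δ / (4 * (volume.real (rect a b) + 1)))
      (by positivity)
    have h5 : sInf S ≤ _ := csInf_le ⟨_, hlb 0⟩ ⟨u, h1, h2, h3, rfl⟩
    have h6 : 4 * (δ / (4 * (volume.real (rect a b) + 1)) * volume.real (rect a b)) ≤ δ := by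
      rw [div_mul_eq_mul_div, ← mul_div_assoc, div_le_iff₀ (by positivity)]
      nlinarith
    rw [hT]
    linarith
  have hup' : torsionalRigidity (rect a b) ≤ a ^ 3 * b / 12 - ∑' k, τ k :=
    ge_of_tendsto' (hτs.hasSum.tendsto_sum_nat.const_sub _) hup
  have hlow' : a ^ 3 * b / 12 - ∑' k, τ k ≤ torsionalRigidity (rect a b) :=
    le_of_tendsto' (hk4.sub hτs.hasSum).tendsto_sum_nat hlow
  have hd := hk5.sub hτs.hasSum
  have hd0 : 0 ≤ 31 * Z * a ^ 4 / (2 * π ^ 5) - ∑' k, τ k :=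
    hd.nonneg fun k => sub_nonneg.2 (mul_le_of_le_one_right (hcoef k) (Real.tanh_lt_one _).le)
  have hd1 : 31 * Z * a ^ 4 / (2 * π ^ 5) - ∑' k, τ k ≤ 32 * a ^ 5 / (b * π ^ 6) * (π ^ 4 / 96) := by
    refine hasSum_le (fun k => ?_) hd (tr_odd4.mul_left (32 * a ^ 5 / (b * π ^ 6)))
    have h1 := mul_le_mul_of_nonneg_left (tr_tanh _ (hxp k)) (hcoef k)
    have h2 : 16 / (a * kap a k ^ 5) - τ k =
      16 / (a * kap a k ^ 5) * (1 - Real.tanh (kap a k * b / 2)) := by simp only [hτ]; ring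
    rw [h2]
    refine h1.trans ?_
    have h3 : 16 / (a * kap a k ^ 5) * (1 / (kap a k * b / 2)) =
        32 * a ^ 5 / (b * π ^ 6) * (1 / (2 * (k : ℝ) + 1) ^ 6) := by
      unfold kap; field_simp; norm_num
    rw [h3]
    gcongr
    · have : (0:ℝ) ≤ k := Nat.cast_nonneg k
      linarith
    · norm_num
  have hd2 : 32 * a ^ 5 / (b * π ^ 6) * (π ^ 4 / 96) ≤ a ^ 5 / (15 * b) := by
    have h1 : 32 * a ^ 5 / (b * π ^ 6) * (π ^ 4 / 96) = a ^ 5 / (3 * π ^ 2 * b) := by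
      field_simp; norm_num
    rw [h1]
    gcongr
    nlinarith [Real.pi_gt_three]
  rw [abs_le]
  constructor
  · have : 0 ≤ a ^ 5 / (15 * b) := by positivity
    linarith
  · linarith
end
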